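/- arXiv:1901.03679 — 7 statements merged into one kernel-verified Lean document; each statement's English description precedes it below -/
import Mathlib

section
/- The monic quintic f has five distinct real roots, i.e., there exist real numbers a1 < a2 < a3 < a4 < a5 with f(X) = (X−a1)(X−a2)(X−a3)(X−a4)(X−a5), if and only if D > 0, L3 > 0, L2 > 0 and L1 > 0. -/
open Polynomial

noncomputable section

def quinticL3 (p q : ℝ) : ℝ := 2*p^2 - 5*q

def quinticL2 (p q r s : ℝ) : ℝ :=
  3*p^2*q^2 - 45*r^2 - 8*p^3*r + 40*q*s + 38*p*q*r - 16*p^2*s - 12*q^3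

def quinticL1 (p q r s t : ℝ) : ℝ :=
  -264*p*r*s^2 - 12*p^3*q^2*t + 36*p*q*r^3 - 124*p*q^2*r*s + 28*p^3*q*r*s + 260*p*q*s*t - 132*p^2*q*r*t + 240*p*r^2*t + 234*q*r^2*s + 32*p^4*r*t + 48*p*q^3*t - 56*p^3*s*t - 80*q^2*r*t + 194*p^2*q*s^2 - 600*r*s*t - 6*p^2*q^3*s + 2*p^2*q^2*r^2 - 12*p^2*r^2*s - 54*r^4 + 320*s^3 - 8*q^3*r^2 - 8*p^3*r^3 + 250*q*t^2 - 176*q^2*s^2 + 24*q^4*s - 36*p^4*s^2 - 100*p^2*t^2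

/-- Positivity of `a x² + 2 x l(v) + q(v)` away from the origin is equivalent to positivity of `a`
and of the Schur complement. -/
lemma forall_quadratic_pos_iff {V : Type*} [Zero V] (a : ℝ) (l q : V → ℝ)
    (hl : l 0 = 0) (hq : q 0 = 0) :
    (∀ x v, (x, v) ≠ (0 : ℝ × V) → 0 < a * x ^ 2 + 2 * x * l v + q v) ↔
      0 < a ∧ ∀ v, v ≠ 0 → 0 < a * q v - l v ^ 2 := by
  constructor
  · intro h
    have ha : 0 < a := by simpa [hl, hq] using h 1 0 (by simp)
    refine ⟨ha, fun v hv => ?_⟩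
    have h1 := mul_pos ha (h (-l v / a) v (by simp [hv]))
    have h2 : a * (a * (-l v / a) ^ 2 + 2 * (-l v / a) * l v + q v) = a * q v - l v ^ 2 := by
      field_simp
      ring
    rwa [h2] at h1
  · rintro ⟨ha, h⟩ x v hxv
    by_cases hv : v = 0
    · have hx : x ≠ 0 := by
        rintro rfl
        exact hxv (by rw [hv]; rfl)
      subst hv
      simpa [hl, hq] using mul_pos ha (by positivity : 0 < x ^ 2)
    · refine pos_of_mul_pos_right (a := a) ?_ ha.le
      nlinarith [h v hv, sq_nonneg (a * x + l v)]

lemma forall_binary_form_pos_iff (a b c : ℝ) :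
    (∀ v : ℝ × ℝ, v ≠ 0 → 0 < a * v.1 ^ 2 + 2 * v.1 * (b * v.2) + c * v.2 ^ 2) ↔
      0 < a ∧ 0 < a * c - b ^ 2 := by
  rw [Prod.forall, forall_quadratic_pos_iff a (fun y : ℝ => b * y) (fun y => c * y ^ 2)
    (by simp) (by simp)]
  refine and_congr_right fun _ => ⟨fun h => by simpa using h 1 one_ne_zero, fun h y hy => ?_⟩
  have := mul_pos h (by positivity : 0 < y ^ 2)
  linarith

/-- Sylvester's criterion for ternary forms. -/
lemma forall_ternary_form_pos_iff (a b c d e f : ℝ) :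
    (∀ v : ℝ × ℝ × ℝ, v ≠ 0 → 0 < a * v.1 ^ 2 + 2 * v.1 * (b * v.2.1 + c * v.2.2) +
        (d * v.2.1 ^ 2 + 2 * v.2.1 * (e * v.2.2) + f * v.2.2 ^ 2)) ↔
      0 < a ∧ 0 < a * d - b ^ 2 ∧
        0 < a * d * f + 2 * b * c * e - a * e ^ 2 - d * c ^ 2 - f * b ^ 2 := by
  rw [Prod.forall, forall_quadratic_pos_iff a (fun v : ℝ × ℝ => b * v.1 + c * v.2)
    (fun v => d * v.1 ^ 2 + 2 * v.1 * (e * v.2) + f * v.2 ^ 2) (by simp) (by simp)]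
  refine and_congr_right fun ha => ?_
  rw [← mul_pos_iff_of_pos_left ha
    (b := a * d * f + 2 * b * c * e - a * e ^ 2 - d * c ^ 2 - f * b ^ 2)]
  refine Iff.trans (forall_congr' fun v => imp_congr_right fun _ => ?_)
    ((forall_binary_form_pos_iff (a * d - b ^ 2) (a * e - b * c) (a * f - c ^ 2)).trans
      (and_congr_right fun _ => ?_))
  all_goals
    rw [iff_iff_eq]
    congr 1
    ring

/-- Sylvester's criterion for quaternary forms. -/
lemma forall_quaternary_form_pos_iff (a b c d e f g h i j : ℝ) :
    (∀ v : ℝ × ℝ × ℝ × ℝ, v ≠ 0 →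
      0 < a * v.1 ^ 2 + 2 * v.1 * (b * v.2.1 + c * v.2.2.1 + d * v.2.2.2) +
        (e * v.2.1 ^ 2 + 2 * v.2.1 * (f * v.2.2.1 + g * v.2.2.2) +
          (h * v.2.2.1 ^ 2 + 2 * v.2.2.1 * (i * v.2.2.2) + j * v.2.2.2 ^ 2))) ↔
      0 < a ∧ 0 < a * e - b ^ 2 ∧
        0 < a * e * h + 2 * b * c * f - a * f ^ 2 - e * c ^ 2 - h * b ^ 2 ∧
        0 < !![a, b, c, d; b, e, f, g; c, f, h, i; d, g, i, j].det := by
  rw [Prod.forall, forall_quadratic_pos_iff a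
    (fun v : ℝ × ℝ × ℝ => b * v.1 + c * v.2.1 + d * v.2.2)
    (fun v => e * v.1 ^ 2 + 2 * v.1 * (f * v.2.1 + g * v.2.2) +
      (h * v.2.1 ^ 2 + 2 * v.2.1 * (i * v.2.2) + j * v.2.2 ^ 2)) (by simp) (by simp)]
  refine and_congr_right fun ha => ?_
  rw [← mul_pos_iff_of_pos_left ha
    (b := a * e * h + 2 * b * c * f - a * f ^ 2 - e * c ^ 2 - h * b ^ 2),
    ← mul_pos_iff_of_pos_left (pow_pos ha 2) (b := Matrix.det _)]
  refine Iff.trans (forall_congr' fun v => imp_congr_right fun _ => ?_)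
    ((forall_ternary_form_pos_iff (a * e - b ^ 2) (a * f - b * c) (a * g - b * d)
      (a * h - c ^ 2) (a * i - c * d) (a * j - d ^ 2)).trans
        (and_congr_right fun _ => and_congr ?_ ?_))
  · rw [iff_iff_eq]
    congr 1
    ring
  · rw [iff_iff_eq]
    congr 1
    ring
  · rw [iff_iff_eq]
    congr 1
    simp [Matrix.det_succ_row_zero, Fin.sum_univ_succ, Fin.succAbove]
    ring

/-- The Newton sums of the roots of `X ^ 5 + p X ^ 4 + q X ^ 3 + r X ^ 2 + s X + t`. -/
def quinticNewtonSum (p q r s t : ℝ) : Fin 7 → ℝ :=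
  ![5, -p, p ^ 2 - 2 * q, -p ^ 3 + 3 * p * q - 3 * r,
    p ^ 4 - 4 * p ^ 2 * q + 4 * p * r + 2 * q ^ 2 - 4 * s,
    -p ^ 5 + 5 * p ^ 3 * q - 5 * p ^ 2 * r - 5 * p * q ^ 2 + 5 * p * s + 5 * q * r - 5 * t,
    p ^ 6 - 6 * p ^ 4 * q + 6 * p ^ 3 * r + 9 * p ^ 2 * q ^ 2 - 6 * p ^ 2 * s - 12 * p * q * r
      + 6 * p * t - 2 * q ^ 3 + 6 * q * s + 3 * r ^ 2]

lemma quinticNewtonSum_eq_sum_pow {p q r s t : ℝ} {z : Fin 5 → ℂ}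
    (hf : (X ^ 5 + C (p : ℂ) * X ^ 4 + C (q : ℂ) * X ^ 3 + C (r : ℂ) * X ^ 2 + C (s : ℂ) * X
      + C (t : ℂ) : Polynomial ℂ) = ∏ i : Fin 5, (X - C (z i))) (k : Fin 7) :
    (quinticNewtonSum p q r s t k : ℂ) = ∑ i, z i ^ (k : ℕ) := by
  have ev (x : ℂ) : x ^ 5 + p * x ^ 4 + q * x ^ 3 + r * x ^ 2 + s * x + t =
      (x - z 0) * (x - z 1) * (x - z 2) * (x - z 3) * (x - z 4) := by
    simpa [Fin.prod_univ_five] using congrArg (Polynomial.eval x) hf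
  rw [Fin.sum_univ_five]
  generalize z 0 = a, z 1 = b, z 2 = c, z 3 = d, z 4 = e at ev ⊢
  have h0 := ev 0
  have h1 := ev 1
  have h2 := ev (-1)
  have h3 := ev 2
  have h4 := ev (-2)
  have ht : (t : ℂ) = -(a * b * c * d * e) := by linear_combination h0
  have hp : (p : ℂ) = -(a + b + c + d + e) := by
    linear_combination (h3 + h4 - 4 * (h1 + h2) + 6 * h0) / 24
  have hr : (r : ℂ) = -(a*b*c + a*b*d + a*b*e + a*c*d + a*c*e + a*d*e + b*c*d + b*c*e + b*d*e
      + c*d*e) := by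
    linear_combination (h1 + h2) / 2 - h0 - hp
  have hq : (q : ℂ) = a*b + a*c + a*d + a*e + b*c + b*d + b*e + c*d + c*e + d*e := by
    linear_combination ((h3 - h4) - 2 * (h1 - h2)) / 12
  have hs : (s : ℂ) = a*b*c*d + a*b*c*e + a*b*d*e + a*c*d*e + b*c*d*e := by
    linear_combination (h1 - h2) / 2 - hq
  fin_cases k <;>
    simp [quinticNewtonSum, hp, hq, hr, hs, ht] <;> ring

/-- The value at `x` of the real polynomial of degree at most three with coefficients `v`. -/
def cubicEval (v : ℝ × ℝ × ℝ × ℝ) (x : ℂ) : ℂ :=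
  v.1 + v.2.1 * x + v.2.2.1 * x ^ 2 + v.2.2.2 * x ^ 3

lemma conj_cubicEval (v : ℝ × ℝ × ℝ × ℝ) (x : ℂ) :
    starRingEnd ℂ (cubicEval v x) = cubicEval v (starRingEnd ℂ x) := by
  simp [cubicEval]

lemma eq_zero_of_cubicEval_eq_zero {v : ℝ × ℝ × ℝ × ℝ} {z : Fin 5 → ℂ}
    (hz : Function.Injective z) (h : ∀ i, cubicEval v (z i) = 0) : v = 0 := by
  set u : Fin 5 → ℂ := ![v.1, v.2.1, v.2.2.1, v.2.2.2, 0] with hu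
  have hsum (j : Fin 5) : ∑ i : Fin 5, z j ^ (i : ℕ) * u i = 0 := by
    rw [← h j]
    simp [Fin.sum_univ_five, cubicEval, hu]
    ring
  have h0 : u = 0 := Matrix.eq_zero_of_forall_index_sum_pow_mul_eq_zero hz hsum
  have h1 := congrFun h0 0
  have h2 := congrFun h0 1
  have h3 := congrFun h0 2
  have h4 := congrFun h0 3
  simp [hu] at h1 h2 h3 h4
  ext <;> simpa

lemma quinticL_pos_iff {p q r s t : ℝ} {z : Fin 5 → ℂ}
    (hf : (X ^ 5 + C (p : ℂ) * X ^ 4 + C (q : ℂ) * X ^ 3 + C (r : ℂ) * X ^ 2 + C (s : ℂ) * X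
      + C (t : ℂ) : Polynomial ℂ) = ∏ i : Fin 5, (X - C (z i))) :
    (0 < quinticL3 p q ∧ 0 < quinticL2 p q r s ∧ 0 < quinticL1 p q r s t) ↔
      ∀ v, v ≠ 0 → 0 < ∑ i, (cubicEval v (z i) ^ 2).re := by
  set N := quinticNewtonSum p q r s t with hN
  have hsum (v : ℝ × ℝ × ℝ × ℝ) : ∑ i, (cubicEval v (z i) ^ 2).re =
      N 0 * v.1 ^ 2 + 2 * v.1 * (N 1 * v.2.1 + N 2 * v.2.2.1 + N 3 * v.2.2.2) +
        (N 2 * v.2.1 ^ 2 + 2 * v.2.1 * (N 3 * v.2.2.1 + N 4 * v.2.2.2) +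
          (N 4 * v.2.2.1 ^ 2 + 2 * v.2.2.1 * (N 5 * v.2.2.2) + N 6 * v.2.2.2 ^ 2)) := by
    rw [← Complex.re_sum, ← Complex.ofReal_re (_ + _)]
    congr 1
    push_cast
    simp only [hN, quinticNewtonSum_eq_sum_pow hf, Fin.sum_univ_five, cubicEval]
    simp
    ring
  simp_rw [hsum]
  rw [forall_quaternary_form_pos_iff]
  have h0 : N 0 = 5 := rfl
  have h3 : N 0 * N 2 - N 1 ^ 2 = 2 * quinticL3 p q := by
    simp [hN, quinticNewtonSum, quinticL3]
    ring
  have h2 : N 0 * N 2 * N 4 + 2 * N 1 * N 2 * N 3 - N 0 * N 3 ^ 2 - N 2 * N 2 ^ 2 - N 4 * N 1 ^ 2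
      = quinticL2 p q r s := by
    simp [hN, quinticNewtonSum, quinticL2]
    ring
  have h1 : !![N 0, N 1, N 2, N 3; N 1, N 2, N 3, N 4; N 2, N 3, N 4, N 5;
      N 3, N 4, N 5, N 6].det = quinticL1 p q r s t := by
    simp [hN, quinticNewtonSum, quinticL1, Matrix.det_succ_row_zero, Fin.sum_univ_succ,
      Fin.succAbove]
    ring
  rw [h1, h2, h3, h0]
  simp

/-- A nontrivial even involution of five letters has at most three orbits. -/
lemma exists_orbit_representatives_of_even_involution :
    ∀ σ : Equiv.Perm (Fin 5), Equiv.Perm.sign σ = 1 → (∀ i, σ (σ i) = i) → σ ≠ 1 →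
      ∃ b : Fin 3 → Fin 5, ∀ i, ∃ k, i = b k ∨ σ i = b k := by
  decide +kernel

lemma prod_sq_sub_eq_det_vandermonde_sq (z : Fin 5 → ℂ) :
    ∏ i : Fin 5, ∏ j ∈ Finset.Ioi i, (z i - z j) ^ 2 = (Matrix.vandermonde z).det ^ 2 := by
  simp_rw [Matrix.det_vandermonde, ← Finset.prod_pow]
  exact Finset.prod_congr rfl fun i _ => Finset.prod_congr rfl fun j _ => by ring

lemma sign_eq_one_of_conj {z : Fin 5 → ℂ} {D : ℝ} (hD : (D : ℂ) = (Matrix.vandermonde z).det ^ 2)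
    (hpos : 0 < D) (σ : Equiv.Perm (Fin 5)) (hσ : ∀ i, z (σ i) = starRingEnd ℂ (z i)) :
    Equiv.Perm.sign σ = 1 := by
  have h1 : starRingEnd ℂ (Matrix.vandermonde z).det =
      (Equiv.Perm.sign σ : ℤ) * (Matrix.vandermonde z).det := by
    rw [← Matrix.det_permute, RingHom.map_det]
    congr 1
    ext i j
    simp [Matrix.vandermonde_apply, hσ]
  refine (Int.units_eq_one_or _).resolve_right fun h => ?_
  rw [h] at h1
  have hre : (Matrix.vandermonde z).det.re = 0 := by
    have := congrArg Complex.re h1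
    simp at this
    linarith
  have := congrArg Complex.re hD
  simp [pow_two, hre] at this
  nlinarith [mul_self_nonneg (Matrix.vandermonde z).det.im]

lemma exists_cubicEval_re_eq_zero (w : Fin 3 → ℂ) :
    ∃ v, v ≠ 0 ∧ ∀ k, (cubicEval v (w k)).re = 0 := by
  let φ : (ℝ × ℝ × ℝ × ℝ) →ₗ[ℝ] (Fin 3 → ℝ) :=
    { toFun := fun v k => (cubicEval v (w k)).re
      map_add' := fun u v => by
        ext k
        simp [cubicEval]
        ring
      map_smul' := fun a v => by
        ext k
        simp [cubicEval]
        ring }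
  obtain ⟨v, hv, hv0⟩ := (Submodule.ne_bot_iff _).mp
    (LinearMap.ker_ne_bot_of_finrank_lt (f := φ) (by simp))
  exact ⟨v, hv0, fun k => congrFun (LinearMap.mem_ker.mp hv) k⟩

lemma exists_perm_conj {p q r s t : ℝ} {z : Fin 5 → ℂ} (hz : Function.Injective z)
    (hf : (X ^ 5 + C (p : ℂ) * X ^ 4 + C (q : ℂ) * X ^ 3 + C (r : ℂ) * X ^ 2 + C (s : ℂ) * X
      + C (t : ℂ) : Polynomial ℂ) = ∏ i : Fin 5, (X - C (z i))) :
    ∃ σ : Equiv.Perm (Fin 5), (∀ i, σ (σ i) = i) ∧ ∀ i, z (σ i) = starRingEnd ℂ (z i) := by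
  have ev (x : ℂ) : x ^ 5 + p * x ^ 4 + q * x ^ 3 + r * x ^ 2 + s * x + t = ∏ i, (x - z i) := by
    simpa [Polynomial.eval_prod] using congrArg (Polynomial.eval x) hf
  have key (i : Fin 5) : ∃ j, z j = starRingEnd ℂ (z i) := by
    have h := congrArg (starRingEnd ℂ)
      ((ev (z i)).trans (Finset.prod_eq_zero (Finset.mem_univ i) (sub_self _)))
    simp only [map_add, map_mul, map_pow, Complex.conj_ofReal, map_zero] at h
    rw [ev, Finset.prod_eq_zero_iff] at h
    obtain ⟨j, -, hj⟩ := h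
    exact ⟨j, (sub_eq_zero.mp hj).symm⟩
  choose σ hσ using key
  have hinv : Function.Involutive σ := fun i => hz (by rw [hσ, hσ, Complex.conj_conj])
  exact ⟨hinv.toPerm σ, hinv, hσ⟩

lemma exists_five_roots_iff {p q r s t : ℝ} {z : Fin 5 → ℂ}
    (hf : (X ^ 5 + C (p : ℂ) * X ^ 4 + C (q : ℂ) * X ^ 3 + C (r : ℂ) * X ^ 2 + C (s : ℂ) * X
      + C (t : ℂ) : Polynomial ℂ) = ∏ i : Fin 5, (X - C (z i))) :
    (∃ a1 a2 a3 a4 a5 : ℝ, a1 < a2 ∧ a2 < a3 ∧ a3 < a4 ∧ a4 < a5 ∧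
      (X ^ 5 + C p * X ^ 4 + C q * X ^ 3 + C r * X ^ 2 + C s * X + C t : Polynomial ℝ) =
        (X - C a1) * (X - C a2) * (X - C a3) * (X - C a4) * (X - C a5)) ↔
      Function.Injective z ∧ ∀ i, (z i).im = 0 := by
  constructor
  · rintro ⟨a1, a2, a3, a4, a5, h12, h23, h34, h45, h⟩
    set a : Fin 5 → ℝ := ![a1, a2, a3, a4, a5] with ha
    have hmono : StrictMono a := by
      rw [Fin.strictMono_iff_lt_succ]
      intro i
      fin_cases i <;> simpa [ha]
    have hprod : ∏ i, (X - C (z i)) = ∏ i, (X - C (a i : ℂ)) := by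
      rw [← hf]
      simpa [Fin.prod_univ_five, ha] using congrArg (Polynomial.map Complex.ofRealHom) h
    have hroots (w : Fin 5 → ℂ) :
        (∏ i, (X - C (w i))).roots = Finset.univ.val.map w := by
      rw [← Polynomial.roots_multiset_prod_X_sub_C (Finset.univ.val.map w), Multiset.map_map]
      rfl
    have hmap : Finset.univ.val.map z = Finset.univ.val.map fun i => (a i : ℂ) := by
      rw [← hroots, ← hroots, hprod]
    constructor
    · have hnodup : (Finset.univ.val.map z).Nodup := by
        rw [hmap]
        exact Finset.univ.nodup.map (Complex.ofReal_injective.comp hmono.injective)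
      exact fun i j => Multiset.inj_on_of_nodup_map hnodup i (Finset.mem_univ i) j
        (Finset.mem_univ j)
    · intro i
      have hi : z i ∈ Finset.univ.val.map z := Multiset.mem_map_of_mem _ (Finset.mem_univ i)
      rw [hmap, Multiset.mem_map] at hi
      obtain ⟨j, -, hj⟩ := hi
      simp [← hj]
  · rintro ⟨hz, him⟩
    have hre (i : Fin 5) : ((z i).re : ℂ) = z i := Complex.ext rfl (him i).symm
    set x : Fin 5 → ℝ := fun i => (z i).re with hx
    have hxinj : Function.Injective x := fun i j hij => hz (by
      rw [← hre i, ← hre j]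
      exact congrArg _ hij)
    have hmono : StrictMono (x ∘ Tuple.sort x) :=
      (Tuple.monotone_sort x).strictMono_of_injective (hxinj.comp (Tuple.sort x).injective)
    refine ⟨_, _, _, _, _, hmono (by decide : (0 : Fin 5) < 1), hmono (by decide : (1 : Fin 5) < 2),
      hmono (by decide : (2 : Fin 5) < 3), hmono (by decide : (3 : Fin 5) < 4), ?_⟩
    apply Polynomial.map_injective Complex.ofRealHom Complex.ofReal_injective
    have hperm := Equiv.prod_comp (Tuple.sort x) fun i => X - C (x i : ℂ)
    simp only [hx, hre] at hperm
    rw [← hf, Fin.prod_univ_five] at hperm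
    simp [hperm, hx, hre]

theorem quintic_five_distinct_real_roots (p q r s t D : ℝ) (z : Fin 5 → ℂ)
    (hf : (X ^ 5 + C (p : ℂ) * X ^ 4 + C (q : ℂ) * X ^ 3 + C (r : ℂ) * X ^ 2 + C (s : ℂ) * X + C (t : ℂ) : Polynomial ℂ) = ∏ i : Fin 5, (X - C (z i)))
    (hD : (D : ℂ) = ∏ i : Fin 5, ∏ j ∈ Finset.Ioi i, (z i - z j) ^ 2) :
    (∃ a1 a2 a3 a4 a5 : ℝ, a1 < a2 ∧ a2 < a3 ∧ a3 < a4 ∧ a4 < a5 ∧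
      (X ^ 5 + C p * X ^ 4 + C q * X ^ 3 + C r * X ^ 2 + C s * X + C t : Polynomial ℝ) =
        (X - C a1) * (X - C a2) * (X - C a3) * (X - C a4) * (X - C a5)) ↔
    (0 < D ∧ 0 < quinticL3 p q ∧ 0 < quinticL2 p q r s ∧ 0 < quinticL1 p q r s t) := by
  rw [exists_five_roots_iff hf, quinticL_pos_iff hf]
  rw [prod_sq_sub_eq_det_vandermonde_sq] at hD
  constructor
  · rintro ⟨hz, him⟩
    have hconj (i : Fin 5) : starRingEnd ℂ (z i) = z i := Complex.conj_eq_iff_im.mpr (him i)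
    constructor
    · have hdet : starRingEnd ℂ (Matrix.vandermonde z).det = (Matrix.vandermonde z).det := by
        rw [RingHom.map_det]
        congr 1
        ext i j
        simp [Matrix.vandermonde_apply, hconj]
      rw [← Complex.conj_eq_iff_re.mp hdet] at hD
      have hne := Matrix.det_vandermonde_ne_zero_iff.mpr hz
      rw [← Complex.conj_eq_iff_re.mp hdet] at hne
      norm_cast at hD hne
      rw [hD]
      positivity
    · intro v hv
      have hsq (i : Fin 5) : (cubicEval v (z i) ^ 2).re = (cubicEval v (z i)).re ^ 2 := by
        have := Complex.conj_eq_iff_im.mp ((conj_cubicEval v (z i)).trans (by rw [hconj]))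
        simp [pow_two, this]
      simp_rw [hsq]
      refine lt_of_le_of_ne (Finset.sum_nonneg fun i _ => sq_nonneg _) fun h => hv ?_
      refine eq_zero_of_cubicEval_eq_zero hz fun i => ?_
      have h0 := (Finset.sum_eq_zero_iff_of_nonneg fun i _ => sq_nonneg _).mp h.symm i
        (Finset.mem_univ i)
      exact Complex.ext (pow_eq_zero_iff two_ne_zero |>.mp h0)
        (Complex.conj_eq_iff_im.mp ((conj_cubicEval v (z i)).trans (by rw [hconj])))
  · rintro ⟨hpos, hform⟩
    have hz : Function.Injective z := by
      rw [← Matrix.det_vandermonde_ne_zero_iff]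
      intro h
      simp [h] at hD
      exact hpos.ne' hD
    refine ⟨hz, ?_⟩
    obtain ⟨σ, hinv, hσ⟩ := exists_perm_conj hz hf
    have hone : σ = 1 := by
      by_contra hne
      obtain ⟨b, hb⟩ := exists_orbit_representatives_of_even_involution σ
        (sign_eq_one_of_conj hD hpos σ hσ) hinv hne
      obtain ⟨v, hv, hvb⟩ := exists_cubicEval_re_eq_zero (z ∘ b)
      refine (hform v hv).not_ge (Finset.sum_nonpos fun i _ => ?_)
      have hi : (cubicEval v (z i)).re = 0 := by
        obtain ⟨k, rfl | hk⟩ := hb i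
        · exact hvb k
        · rw [← Complex.conj_re, conj_cubicEval, ← hσ, hk]
          exact hvb k
      simp [pow_two, hi, mul_self_nonneg]
    intro i
    rw [← Complex.conj_eq_iff_im, ← hσ, hone, Equiv.Perm.one_apply]
end
end

section
/- The monic quintic f has exactly one real root, which is simple, together with four distinct nonreal simple roots — i.e., there exist a real number a and nonreal w1, w2 ∈ ℂ with w1, conj(w1), w2, conj(w2) pairwise distinct and f(X) = (X−a)(X−w1)(X−conj(w1))(X−w2)(X−conj(w2)) over ℂ — if and only if D > 0 and (L3 ≤ 0 or L2 ≤ 0 or L1 ≤ 0). -/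
open Polynomial

noncomputable section

lemma quadForm_two_eq_zero {a b c x y : ℝ} (h₁ : 0 < a) (h₂ : 0 < a * c - b ^ 2)
    (h : a * x ^ 2 + c * y ^ 2 + 2 * b * x * y ≤ 0) : x = 0 ∧ y = 0 := by
  have key : (a * x + b * y) ^ 2 + (a * c - b ^ 2) * y ^ 2 ≤ 0 := by
    have := mul_nonpos_of_nonneg_of_nonpos h₁.le h
    linarith
  have hy : y = 0 := by
    by_contra hy
    have : 0 < y ^ 2 := by positivity
    nlinarith [sq_nonneg (a * x + b * y), mul_pos h₂ this]
  subst hy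
  refine ⟨?_, rfl⟩
  by_contra hx
  have : 0 < x ^ 2 := by positivity
  nlinarith [mul_pos h₁ this]

lemma quadForm_three_eq_zero {a b c d e f x y z : ℝ} (h₁ : 0 < a) (h₂ : 0 < a * d - b ^ 2)
    (h₃ : 0 < a * d * f + 2 * b * c * e - a * e ^ 2 - d * c ^ 2 - f * b ^ 2)
    (h : a * x ^ 2 + d * y ^ 2 + f * z ^ 2 + 2 * b * x * y + 2 * c * x * z + 2 * e * y * z ≤ 0) :
    x = 0 ∧ y = 0 ∧ z = 0 := by
  have hyz : y = 0 ∧ z = 0 := by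
    refine quadForm_two_eq_zero (b := a * e - b * c) (c := a * f - c ^ 2) h₂ ?_ ?_
    · have := mul_pos h₁ h₃
      linarith
    · have := mul_nonpos_of_nonneg_of_nonpos h₁.le h
      linarith [sq_nonneg (a * x + b * y + c * z)]
  obtain ⟨rfl, rfl⟩ := hyz
  refine ⟨?_, rfl, rfl⟩
  by_contra hx
  have : 0 < x ^ 2 := by positivity
  nlinarith [mul_pos h₁ this]

/-- A quadratic form in four variables with positive leading principal minors is positive away
from the origin (Sylvester's criterion). -/
lemma quadForm_four_eq_zero {a b c d e f g k l m x y z w : ℝ}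
    (h₁ : 0 < a) (h₂ : 0 < a * e - b ^ 2)
    (h₃ : 0 < a * e * k + 2 * b * c * f - a * f ^ 2 - e * c ^ 2 - k * b ^ 2)
    (h₄ : 0 < (!![a, b, c, d; b, e, f, g; c, f, k, l; d, g, l, m] : Matrix _ _ ℝ).det)
    (h : a * x ^ 2 + e * y ^ 2 + k * z ^ 2 + m * w ^ 2 + 2 * b * x * y + 2 * c * x * z +
      2 * d * x * w + 2 * f * y * z + 2 * g * y * w + 2 * l * z * w ≤ 0) :
    x = 0 ∧ y = 0 ∧ z = 0 ∧ w = 0 := by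
  have hyzw : y = 0 ∧ z = 0 ∧ w = 0 := by
    refine quadForm_three_eq_zero (b := a * f - b * c) (c := a * g - b * d) (d := a * k - c ^ 2)
      (e := a * l - c * d) (f := a * m - d ^ 2) h₂ ?_ ?_ ?_
    · have := mul_pos h₁ h₃
      linarith
    · have := mul_pos (mul_pos h₁ h₁) h₄
      simp [Matrix.det_succ_row_zero, Fin.sum_univ_succ, Fin.succAbove] at this
      linarith
    · have := mul_nonpos_of_nonneg_of_nonpos h₁.le h
      linarith [sq_nonneg (a * x + b * y + c * z + d * w)]
  obtain ⟨rfl, rfl, rfl⟩ := hyzw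
  refine ⟨?_, rfl, rfl, rfl⟩
  by_contra hx
  have : 0 < x ^ 2 := by positivity
  nlinarith [mul_pos h₁ this]

lemma quintic_coeffs {R : Type*} [CommRing R] {p q r s t : R} {z : Fin 5 → R}
    (h : (X ^ 5 + C p * X ^ 4 + C q * X ^ 3 + C r * X ^ 2 + C s * X + C t : R[X]) =
      ∏ i, (X - C (z i))) :
    p = -(z 0 + z 1 + z 2 + z 3 + z 4) ∧
    q = z 0 * z 1 + z 0 * z 2 + z 0 * z 3 + z 0 * z 4 + z 1 * z 2 + z 1 * z 3 + z 1 * z 4 +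
      z 2 * z 3 + z 2 * z 4 + z 3 * z 4 ∧
    r = -(z 0 * z 1 * z 2 + z 0 * z 1 * z 3 + z 0 * z 1 * z 4 + z 0 * z 2 * z 3 +
      z 0 * z 2 * z 4 + z 0 * z 3 * z 4 + z 1 * z 2 * z 3 + z 1 * z 2 * z 4 + z 1 * z 3 * z 4 +
      z 2 * z 3 * z 4) ∧
    s = z 0 * z 1 * z 2 * z 3 + z 0 * z 1 * z 2 * z 4 + z 0 * z 1 * z 3 * z 4 +
      z 0 * z 2 * z 3 * z 4 + z 1 * z 2 * z 3 * z 4 ∧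
    t = -(z 0 * z 1 * z 2 * z 3 * z 4) := by
  have h' : (∏ i, (X - C (z i)) : R[X]) =
      X ^ 5 + C (-(z 0 + z 1 + z 2 + z 3 + z 4)) * X ^ 4 +
      C (z 0 * z 1 + z 0 * z 2 + z 0 * z 3 + z 0 * z 4 + z 1 * z 2 + z 1 * z 3 + z 1 * z 4 +
        z 2 * z 3 + z 2 * z 4 + z 3 * z 4) * X ^ 3 +
      C (-(z 0 * z 1 * z 2 + z 0 * z 1 * z 3 + z 0 * z 1 * z 4 + z 0 * z 2 * z 3 +
        z 0 * z 2 * z 4 + z 0 * z 3 * z 4 + z 1 * z 2 * z 3 + z 1 * z 2 * z 4 +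
        z 1 * z 3 * z 4 + z 2 * z 3 * z 4)) * X ^ 2 +
      C (z 0 * z 1 * z 2 * z 3 + z 0 * z 1 * z 2 * z 4 + z 0 * z 1 * z 3 * z 4 +
        z 0 * z 2 * z 3 * z 4 + z 1 * z 2 * z 3 * z 4) * X +
      C (-(z 0 * z 1 * z 2 * z 3 * z 4)) := by
    simp only [Fin.prod_univ_five, map_add, map_mul, map_neg]
    ring
  rw [h'] at h
  have hc (k : ℕ) := congrArg (fun f : R[X] ↦ f.coeff k) h
  simp only [coeff_add, coeff_C_mul, coeff_X_pow, coeff_X, coeff_C] at hc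
  exact ⟨by simpa using hc 4, by simpa using hc 3, by simpa using hc 2, by simpa using hc 1,
    by simpa using hc 0⟩

/-- The subdiscriminants of a quintic are the leading principal minors of the Hankel matrix of the
power sums of its roots, which are given by Newton's identities. -/
lemma hankel_minors_eq {p q r s t s₁ s₂ s₃ s₄ s₅ s₆ : ℝ} (h₁ : s₁ = -p)
    (h₂ : s₂ = -(p * s₁ + 2 * q)) (h₃ : s₃ = -(p * s₂ + q * s₁ + 3 * r))
    (h₄ : s₄ = -(p * s₃ + q * s₂ + r * s₁ + 4 * s))
    (h₅ : s₅ = -(p * s₄ + q * s₃ + r * s₂ + s * s₁ + 5 * t))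
    (h₆ : s₆ = -(p * s₅ + q * s₄ + r * s₃ + s * s₂ + t * s₁)) :
    (!![5, s₁; s₁, s₂] : Matrix _ _ ℝ).det = 2 * quinticL3 p q ∧
    (!![5, s₁, s₂; s₁, s₂, s₃; s₂, s₃, s₄] : Matrix _ _ ℝ).det = quinticL2 p q r s ∧
    (!![5, s₁, s₂, s₃; s₁, s₂, s₃, s₄; s₂, s₃, s₄, s₅; s₃, s₄, s₅, s₆] : Matrix _ _ ℝ).det =
      quinticL1 p q r s t := by
  subst h₁ h₂ h₃ h₄ h₅ h₆
  refine ⟨?_, ?_, ?_⟩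
  · rw [Matrix.det_fin_two_of, quinticL3]
    ring
  · simp [Matrix.det_fin_three, quinticL2]
    ring
  · simp [Matrix.det_succ_row_zero, Fin.sum_univ_succ, Fin.succAbove, quinticL1]
    ring

lemma det_powerSums_pos {n k : ℕ} (hk : k ≤ n) {x : Fin n → ℝ} (hx : Function.Injective x) :
    0 < (Matrix.of fun i j : Fin k ↦ ∑ m, x m ^ (i + j : ℕ)).det := by
  let B : Matrix (Fin n) (Fin k) ℝ := Matrix.of fun m i ↦ x m ^ (i : ℕ)
  have hB : (Matrix.of fun i j : Fin k ↦ ∑ m, x m ^ (i + j : ℕ)) = B.conjTranspose * B := by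
    ext i j
    simp [B, Matrix.mul_apply, pow_add]
  rw [hB]
  refine (Matrix.PosDef.conjTranspose_mul_self B ?_).det_pos
  rw [← Matrix.coe_mulVecLin, ← LinearMap.ker_eq_bot, LinearMap.ker_eq_bot']
  intro v hv
  have hxk : Function.Injective fun i : Fin k ↦ x (Fin.castLE hk i) :=
    hx.comp (Fin.castLE_injective hk)
  refine Matrix.eq_zero_of_forall_index_sum_pow_mul_eq_zero hxk fun i ↦ ?_
  exact congrFun hv (Fin.castLE hk i)

lemma subdiscriminants_pos {p q r s t : ℝ} {x : Fin 5 → ℝ} (hx : Function.Injective x)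
    (h : (X ^ 5 + C p * X ^ 4 + C q * X ^ 3 + C r * X ^ 2 + C s * X + C t : ℝ[X]) =
      ∏ i, (X - C (x i))) :
    0 < quinticL3 p q ∧ 0 < quinticL2 p q r s ∧ 0 < quinticL1 p q r s t := by
  obtain ⟨hp, hq, hr, hs, ht⟩ := quintic_coeffs h
  obtain ⟨e₃, e₂, e₁⟩ := hankel_minors_eq (p := p) (q := q) (r := r) (s := s) (t := t)
    (s₁ := ∑ m, x m) (s₂ := ∑ m, x m ^ 2) (s₃ := ∑ m, x m ^ 3) (s₄ := ∑ m, x m ^ 4)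
    (s₅ := ∑ m, x m ^ 5) (s₆ := ∑ m, x m ^ 6)
    (by rw [hp, Fin.sum_univ_five]; ring)
    (by simp only [hp, hq, Fin.sum_univ_five]; ring)
    (by simp only [hp, hq, hr, Fin.sum_univ_five]; ring)
    (by simp only [hp, hq, hr, hs, Fin.sum_univ_five]; ring)
    (by simp only [hp, hq, hr, hs, ht, Fin.sum_univ_five]; ring)
    (by simp only [hp, hq, hr, hs, ht, Fin.sum_univ_five]; ring)
  refine ⟨?_, ?_, ?_⟩
  · rw [← mul_pos_iff_of_pos_left two_pos, ← e₃]
    refine (det_powerSums_pos (show 2 ≤ 5 by decide) hx).trans_eq (congrArg Matrix.det ?_)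
    ext i j
    fin_cases i <;> fin_cases j <;> simp
  · rw [← e₂]
    refine (det_powerSums_pos (show 3 ≤ 5 by decide) hx).trans_eq (congrArg Matrix.det ?_)
    ext i j
    fin_cases i <;> fin_cases j <;> simp
  · rw [← e₁]
    refine (det_powerSums_pos (show 4 ≤ 5 by decide) hx).trans_eq (congrArg Matrix.det ?_)
    ext i j
    fin_cases i <;> fin_cases j <;> simp

/-- The product of the squared differences of the roots only depends on the polynomial. -/
lemma prod_sub_sq_eq_of_prod_X_sub_C_eq {R : Type*} [CommRing R] [IsDomain R] {n : ℕ}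
    {w z : Fin n → R} (h : ∏ i, (X - C (w i)) = ∏ i, (X - C (z i))) :
    ∏ i, ∏ j ∈ Finset.Ioi i, (w i - w j) ^ 2 = ∏ i, ∏ j ∈ Finset.Ioi i, (z i - z j) ^ 2 := by
  have hdet (v : Fin n → R) : ∏ i, ∏ j ∈ Finset.Ioi i, (v i - v j) ^ 2 =
      ((Matrix.vandermonde v).transpose * Matrix.vandermonde v).det := by
    rw [Matrix.det_mul, Matrix.det_transpose, Matrix.det_vandermonde, ← sq]
    simp only [← Finset.prod_pow]
    exact Finset.prod_congr rfl fun i _ ↦ Finset.prod_congr rfl fun j _ ↦ sub_sq_comm _ _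
  have hroots : Multiset.map w Finset.univ.val = Multiset.map z Finset.univ.val := by
    have hr (v : Fin n → R) : (∏ i, (X - C (v i))).roots = Multiset.map v Finset.univ.val := by
      rw [← roots_multiset_prod_X_sub_C (Multiset.map v Finset.univ.val), Multiset.map_map]
      rfl
    rw [← hr, ← hr, h]
  rw [hdet, hdet]
  congr 1
  ext i j
  rw [Matrix.vandermonde_transpose_mul_vandermonde, Matrix.vandermonde_transpose_mul_vandermonde]
  have hsum := congrArg (fun m ↦ (Multiset.map (fun x ↦ x ^ ((i : ℕ) + j)) m).sum) hroots
  simp only [Multiset.map_map] at hsum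
  exact hsum

/-- Hermite's quadratic form of a real quintic with two pairs of conjugate roots is not positive
definite on polynomials of degree at most three. -/
lemma not_subdiscriminants_pos {p q r s t a x y u v : ℝ}
    (hp : p = -(a + 2 * x + 2 * u))
    (hq : q = a * (2 * x + 2 * u) + (x ^ 2 + y ^ 2) + (u ^ 2 + v ^ 2) + 4 * x * u)
    (hr : r = -(a * ((x ^ 2 + y ^ 2) + (u ^ 2 + v ^ 2) + 4 * x * u) +
      2 * x * (u ^ 2 + v ^ 2) + 2 * u * (x ^ 2 + y ^ 2)))
    (hs : s = a * (2 * x * (u ^ 2 + v ^ 2) + 2 * u * (x ^ 2 + y ^ 2)) +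
      (x ^ 2 + y ^ 2) * (u ^ 2 + v ^ 2))
    (ht : t = -(a * (x ^ 2 + y ^ 2) * (u ^ 2 + v ^ 2)))
    (h₃ : 0 < quinticL3 p q) (h₂ : 0 < quinticL2 p q r s) (h₁ : 0 < quinticL1 p q r s t) :
    False := by
  obtain ⟨c, hc, hc0⟩ := Submodule.exists_mem_ne_zero_of_ne_bot
    (LinearMap.ker_ne_bot_of_finrank_lt (f := Matrix.mulVecLin
      (!![1, a, a ^ 2, a ^ 3; 1, x, x ^ 2 - y ^ 2, x ^ 3 - 3 * x * y ^ 2;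
        1, u, u ^ 2 - v ^ 2, u ^ 3 - 3 * u * v ^ 2] : Matrix (Fin 3) (Fin 4) ℝ)) (by simp))
  rw [LinearMap.mem_ker, Matrix.mulVecLin_apply] at hc
  have e₀ := congrFun hc 0
  have e₁ := congrFun hc 1
  have e₂ := congrFun hc 2
  simp [Matrix.mulVec, dotProduct, Fin.sum_univ_four] at e₀ e₁ e₂
  obtain ⟨m₃, m₂, m₁⟩ := hankel_minors_eq (p := p) (q := q) (r := r) (s := s) (t := t)
    (s₁ := a + 2 * x + 2 * u)
    (s₂ := a ^ 2 + 2 * (x ^ 2 - y ^ 2) + 2 * (u ^ 2 - v ^ 2))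
    (s₃ := a ^ 3 + 2 * (x ^ 3 - 3 * x * y ^ 2) + 2 * (u ^ 3 - 3 * u * v ^ 2))
    (s₄ := a ^ 4 + 2 * ((x ^ 2 - y ^ 2) ^ 2 - (2 * x * y) ^ 2) +
      2 * ((u ^ 2 - v ^ 2) ^ 2 - (2 * u * v) ^ 2))
    (s₅ := a ^ 5 + 2 * (x ^ 5 - 10 * x ^ 3 * y ^ 2 + 5 * x * y ^ 4) +
      2 * (u ^ 5 - 10 * u ^ 3 * v ^ 2 + 5 * u * v ^ 4))
    (s₆ := a ^ 6 + 2 * ((x ^ 3 - 3 * x * y ^ 2) ^ 2 - (3 * x ^ 2 * y - y ^ 3) ^ 2) +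
      2 * ((u ^ 3 - 3 * u * v ^ 2) ^ 2 - (3 * u ^ 2 * v - v ^ 3) ^ 2))
    (by rw [hp]; ring) (by rw [hp, hq]; ring) (by rw [hp, hq, hr]; ring)
    (by rw [hp, hq, hr, hs]; ring) (by rw [hp, hq, hr, hs, ht]; ring)
    (by rw [hp, hq, hr, hs, ht]; ring)
  rw [← m₁] at h₁
  rw [← m₂, Matrix.det_fin_three] at h₂
  rw [← mul_pos_iff_of_pos_left two_pos, ← m₃, Matrix.det_fin_two_of] at h₃
  have key := quadForm_four_eq_zero (x := c 0) (y := c 1) (z := c 2) (w := c 3)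
    (by norm_num) ?_ ?_ h₁ ?_
  · apply hc0
    ext i
    fin_cases i
    exacts [key.1, key.2.1, key.2.2.1, key.2.2.2]
  · linarith
  · simp at h₂
    linarith
  · have hneg : -2 * (c 1 * y + c 2 * (2 * x * y) + c 3 * (3 * x ^ 2 * y - y ^ 3)) ^ 2 -
        2 * (c 1 * v + c 2 * (2 * u * v) + c 3 * (3 * u ^ 2 * v - v ^ 3)) ^ 2 ≤ 0 := by
      linarith [sq_nonneg (c 1 * y + c 2 * (2 * x * y) + c 3 * (3 * x ^ 2 * y - y ^ 3)),
        sq_nonneg (c 1 * v + c 2 * (2 * u * v) + c 3 * (3 * u ^ 2 * v - v ^ 3))]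
    refine le_of_eq_of_le ?_ hneg
    linear_combination (c 0 + a * c 1 + a ^ 2 * c 2 + a ^ 3 * c 3) * e₀ +
      2 * (c 0 + x * c 1 + (x ^ 2 - y ^ 2) * c 2 + (x ^ 3 - 3 * x * y ^ 2) * c 3) * e₁ +
      2 * (c 0 + u * c 1 + (u ^ 2 - v ^ 2) * c 2 + (u ^ 3 - 3 * u * v ^ 2) * c 3) * e₂

lemma Polynomial.Monic.exists_eq_quadratic_mul {P : ℝ[X]} (hP : P.Monic) {w : ℂ}
    (h0 : aeval w P = 0) (hw : w.im ≠ 0) {n : ℕ} (hn : P.natDegree = n + 2) :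
    ∃ G : ℝ[X], G.Monic ∧ G.natDegree = n ∧
      P.map (algebraMap ℝ ℂ) =
        (X - C w) * (X - C ((starRingEnd ℂ) w)) * G.map (algebraMap ℝ ℂ) := by
  obtain ⟨G, rfl⟩ := P.quadratic_dvd_of_aeval_eq_zero_im_ne_zero h0 hw
  have hQ : (X ^ 2 - C (2 * w.re) * X + C (‖w‖ ^ 2)).Monic := by monicity!
  have hQd : (X ^ 2 - C (2 * w.re) * X + C (‖w‖ ^ 2)).natDegree = 2 := by compute_degree!
  have hG := hQ.of_mul_monic_left hP
  refine ⟨G, hG, ?_, ?_⟩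
  · rw [hQ.natDegree_mul hG, hQd] at hn
    lia
  · rw [Polynomial.map_mul]
    congr 1
    calc
      Polynomial.map (algebraMap ℝ ℂ) (X ^ 2 - C (2 * w.re) * X + C (‖w‖ ^ 2))
      _ = X ^ 2 - C (↑(2 * w.re) : ℂ) * X + C (‖w‖ ^ 2 : ℂ) := by simp
      _ = (X - C w) * (X - C ((starRingEnd ℂ) w)) := by
        rw [← Complex.add_conj, map_add, ← Complex.mul_conj', map_mul]
        ring

lemma prod_sub_sq_five {R : Type*} [CommRing R] (v : Fin 5 → R) :
    ∏ i, ∏ j ∈ Finset.Ioi i, (v i - v j) ^ 2 =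
      ((v 0 - v 1) * (v 0 - v 2) * (v 0 - v 3) * (v 0 - v 4) * (v 1 - v 2) * (v 1 - v 3) *
        (v 1 - v 4) * (v 2 - v 3) * (v 2 - v 4) * (v 3 - v 4)) ^ 2 := by
  rw [Fin.prod_univ_five, show Finset.Ioi (0 : Fin 5) = {1, 2, 3, 4} by decide,
    show Finset.Ioi (1 : Fin 5) = {2, 3, 4} by decide,
    show Finset.Ioi (2 : Fin 5) = {3, 4} by decide, show Finset.Ioi (3 : Fin 5) = {4} by decide,
    show Finset.Ioi (4 : Fin 5) = ∅ by decide]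
  simp [mul_pow, mul_assoc]

lemma sub_conj_sq (w : ℂ) : (w - (starRingEnd ℂ) w) ^ 2 = -(2 * w.im : ℂ) ^ 2 := by
  rw [Complex.sub_conj, mul_pow, Complex.I_sq]
  push_cast
  ring

/-- The discriminant of a quintic with two pairs of conjugate roots is a real square. -/
lemma prod_sub_sq_two_conj_pairs (a : ℝ) (w₁ w₂ : ℂ) :
    ∏ i, ∏ j ∈ Finset.Ioi i,
      ((![(a : ℂ), w₁, (starRingEnd ℂ) w₁, w₂, (starRingEnd ℂ) w₂] : Fin 5 → ℂ) i -
        (![(a : ℂ), w₁, (starRingEnd ℂ) w₁, w₂, (starRingEnd ℂ) w₂] : Fin 5 → ℂ) j) ^ 2 =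
      (((2 * w₁.im) * (2 * w₂.im) * Complex.normSq (a - w₁) * Complex.normSq (a - w₂) *
        Complex.normSq (w₁ - w₂) * Complex.normSq (w₁ - (starRingEnd ℂ) w₂)) ^ 2 : ℝ) := by
  rw [prod_sub_sq_five]
  push_cast
  simp only [← Complex.mul_conj, map_sub, Complex.conj_conj, Complex.conj_ofReal, mul_pow]
  have h₁ := sub_conj_sq w₁
  have h₂ := sub_conj_sq w₂
  rw [mul_pow] at h₁ h₂
  rw [← neg_mul_neg (2 ^ 2 * (w₁.im : ℂ) ^ 2), ← h₁, ← h₂]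
  generalize w₁ - (starRingEnd ℂ) w₁ = d₁
  generalize w₂ - (starRingEnd ℂ) w₂ = d₂
  generalize (a : ℂ) - w₁ = d₃
  generalize (a : ℂ) - (starRingEnd ℂ) w₁ = d₄
  generalize (a : ℂ) - w₂ = d₅
  generalize (a : ℂ) - (starRingEnd ℂ) w₂ = d₆
  generalize w₁ - w₂ = d₇
  generalize w₁ - (starRingEnd ℂ) w₂ = d₈
  generalize (starRingEnd ℂ) w₁ - w₂ = d₉
  generalize (starRingEnd ℂ) w₁ - (starRingEnd ℂ) w₂ = d₀
  ring

/-- The discriminant of a quintic with three real roots and a pair of conjugate roots is the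
negative of a real square. -/
lemma prod_sub_sq_one_conj_pair (a b c : ℝ) (w : ℂ) :
    ∏ i, ∏ j ∈ Finset.Ioi i,
      ((![w, (starRingEnd ℂ) w, (a : ℂ), (b : ℂ), (c : ℂ)] : Fin 5 → ℂ) i -
        (![w, (starRingEnd ℂ) w, (a : ℂ), (b : ℂ), (c : ℂ)] : Fin 5 → ℂ) j) ^ 2 =
      (-((2 * w.im) * Complex.normSq (w - a) * Complex.normSq (w - b) * Complex.normSq (w - c) *
        ((a - b) * (a - c) * (b - c))) ^ 2 : ℝ) := by
  rw [prod_sub_sq_five]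
  push_cast
  simp only [← Complex.mul_conj, map_sub, Complex.conj_ofReal]
  have h := sub_conj_sq w
  generalize w - (starRingEnd ℂ) w = d₀ at h ⊢
  generalize w - (a : ℂ) = d₁
  generalize w - (b : ℂ) = d₂
  generalize w - (c : ℂ) = d₃
  generalize (starRingEnd ℂ) w - (a : ℂ) = d₄
  generalize (starRingEnd ℂ) w - (b : ℂ) = d₅
  generalize (starRingEnd ℂ) w - (c : ℂ) = d₆
  generalize (a : ℂ) - b = d₇
  generalize (a : ℂ) - c = d₈
  generalize (b : ℂ) - c = d₉
  linear_combination (d₁ * d₂ * d₃ * d₄ * d₅ * d₆ * d₇ * d₈ * d₉) ^ 2 * h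

/-- A monic real cubic either has only real roots or has a pair of conjugate nonreal roots. -/
lemma Polynomial.Monic.cubic_eq {G : ℝ[X]} (hG : G.Monic) (hd : G.natDegree = 3) :
    (∃ a b c : ℝ, G.map (algebraMap ℝ ℂ) = (X - C (a : ℂ)) * (X - C (b : ℂ)) * (X - C (c : ℂ))) ∨
    ∃ (a : ℝ) (w : ℂ), w.im ≠ 0 ∧
      G.map (algebraMap ℝ ℂ) = (X - C w) * (X - C ((starRingEnd ℂ) w)) * (X - C (a : ℂ)) := by
  by_cases hw : ∃ w : ℂ, aeval w G = 0 ∧ w.im ≠ 0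
  · obtain ⟨w, h0, hw⟩ := hw
    obtain ⟨L, hL, hLd, h⟩ := hG.exists_eq_quadratic_mul h0 hw hd
    refine Or.inr ⟨-L.coeff 0, w, hw, ?_⟩
    have hL' : L = X + C (L.coeff 0) := hL.eq_X_add_C hLd
    rw [h, hL']
    simp
  · push Not at hw
    have hmon : (G.map (algebraMap ℝ ℂ)).Monic := hG.map _
    have hcard : (G.map (algebraMap ℝ ℂ)).roots.card = 3 := by
      rw [← (IsAlgClosed.splits _).natDegree_eq_card_roots, hG.natDegree_map, hd]
    obtain ⟨α, β, γ, hr⟩ := Multiset.card_eq_three.1 hcard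
    have hreal (v : ℂ) (hv : v ∈ (G.map (algebraMap ℝ ℂ)).roots) : ((v.re : ℝ) : ℂ) = v := by
      refine Complex.ext rfl (hw v ?_).symm
      rw [mem_roots hmon.ne_zero, IsRoot, eval_map_algebraMap] at hv
      exact hv
    refine Or.inl ⟨α.re, β.re, γ.re, ?_⟩
    rw [hreal α (by simp [hr]), hreal β (by simp [hr]), hreal γ (by simp [hr])]
    have h := (IsAlgClosed.splits (G.map (algebraMap ℝ ℂ))).eq_prod_roots_of_monic hmon
    rw [hr] at h
    rw [h]
    simp [mul_assoc]

theorem quintic_one_real_four_nonreal (p q r s t D : ℝ) (z : Fin 5 → ℂ)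
    (hf : (X ^ 5 + C (p : ℂ) * X ^ 4 + C (q : ℂ) * X ^ 3 + C (r : ℂ) * X ^ 2 + C (s : ℂ) * X + C (t : ℂ) : Polynomial ℂ) = ∏ i : Fin 5, (X - C (z i)))
    (hD : (D : ℂ) = ∏ i : Fin 5, ∏ j ∈ Finset.Ioi i, (z i - z j) ^ 2) :
    (∃ (a : ℝ) (w1 w2 : ℂ), w1.im ≠ 0 ∧ w2.im ≠ 0 ∧
      w1 ≠ (starRingEnd ℂ) w1 ∧ w1 ≠ w2 ∧ w1 ≠ (starRingEnd ℂ) w2 ∧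
      (starRingEnd ℂ) w1 ≠ w2 ∧ (starRingEnd ℂ) w1 ≠ (starRingEnd ℂ) w2 ∧ w2 ≠ (starRingEnd ℂ) w2 ∧
      (X ^ 5 + C (p : ℂ) * X ^ 4 + C (q : ℂ) * X ^ 3 + C (r : ℂ) * X ^ 2 + C (s : ℂ) * X + C (t : ℂ) : Polynomial ℂ) =
        (X - C (a : ℂ)) * (X - C w1) * (X - C ((starRingEnd ℂ) w1)) *
          (X - C w2) * (X - C ((starRingEnd ℂ) w2))) ↔
    (0 < D ∧ (quinticL3 p q ≤ 0 ∨ quinticL2 p q r s ≤ 0 ∨ quinticL1 p q r s t ≤ 0)) := by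
  set f : ℂ[X] := X ^ 5 + C (p : ℂ) * X ^ 4 + C (q : ℂ) * X ^ 3 + C (r : ℂ) * X ^ 2 +
    C (s : ℂ) * X + C (t : ℂ) with hf_def
  constructor
  · rintro ⟨a, w₁, w₂, hw₁, hw₂, -, h₁₂, h₁₂', -, -, -, h⟩
    have hv : f = ∏ i, (X - C ((![(a : ℂ), w₁, (starRingEnd ℂ) w₁, w₂, (starRingEnd ℂ) w₂] :
        Fin 5 → ℂ) i)) := by
      rw [h, Fin.prod_univ_five]
      rfl
    have ha {w : ℂ} (hw : w.im ≠ 0) : (a : ℂ) - w ≠ 0 := by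
      intro h0
      exact hw (by simpa using congrArg Complex.im h0)
    refine ⟨?_, ?_⟩
    · rw [← prod_sub_sq_eq_of_prod_X_sub_C_eq (hv.symm.trans hf), prod_sub_sq_two_conj_pairs,
        Complex.ofReal_inj] at hD
      rw [hD]
      have := ha hw₁
      have := ha hw₂
      have := sub_ne_zero.2 h₁₂
      have := sub_ne_zero.2 h₁₂'
      refine sq_pos_of_ne_zero ?_
      simp only [ne_eq, mul_eq_zero, Complex.normSq_eq_zero, OfNat.ofNat_ne_zero, not_or,
        not_false_eq_true, true_and]
      tauto
    · by_contra! hL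
      obtain ⟨hp, hq, hr, hs, ht⟩ := quintic_coeffs hv
      simp only [Matrix.cons_val] at hp hq hr hs ht
      refine not_subdiscriminants_pos (a := a) (x := w₁.re) (y := w₁.im) (u := w₂.re)
        (v := w₂.im) ?_ ?_ ?_ ?_ ?_ hL.1 hL.2.1 hL.2.2
      · have := congrArg Complex.re hp
        simp at this
        linarith
      · have := congrArg Complex.re hq
        simp at this
        linarith
      · have := congrArg Complex.re hr
        simp at this
        linarith
      · have := congrArg Complex.re hs
        simp at this
        linarith
      · have := congrArg Complex.re ht
        simp at this
        linarith
  · rintro ⟨hpos, hL⟩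
    have hinj : Function.Injective z := by
      have hD0 : (∏ i, ∏ j ∈ Finset.Ioi i, (z i - z j) ^ 2) ≠ 0 := by
        rw [← hD]
        exact_mod_cast hpos.ne'
      rw [← Matrix.det_vandermonde_ne_zero_iff, Matrix.det_vandermonde]
      simp only [Finset.prod_ne_zero_iff] at hD0 ⊢
      intro i hi j hj
      rw [← neg_sub, neg_ne_zero]
      exact ne_zero_pow two_ne_zero (hD0 i hi j hj)
    let F : ℝ[X] := X ^ 5 + C p * X ^ 4 + C q * X ^ 3 + C r * X ^ 2 + C s * X + C t
    have hF : F.Monic := by unfold F; monicity!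
    have hFd : F.natDegree = 5 := by unfold F; compute_degree!
    have hFf : F.map (algebraMap ℝ ℂ) = f := by simp [F, hf_def]
    have hroot (i : Fin 5) : aeval (z i) F = 0 := by
      rw [← eval_map_algebraMap, hFf, hf, eval_prod]
      exact Finset.prod_eq_zero (Finset.mem_univ i) (by simp)
    obtain ⟨i, hi⟩ : ∃ i, (z i).im ≠ 0 := by
      by_contra! him
      have hz (i : Fin 5) : z i = ((z i).re : ℂ) := Complex.ext rfl (him i)
      have hFx : F = ∏ i, (X - C (z i).re) := by
        apply Polynomial.map_injective _ (algebraMap ℝ ℂ).injective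
        rw [hFf, hf, Polynomial.map_prod]
        refine Finset.prod_congr rfl fun i _ ↦ ?_
        rw [hz i]
        simp
      have hx : Function.Injective fun i ↦ (z i).re := fun i j hij ↦ hinj <| by
        rw [hz i, hz j]
        exact congrArg _ hij
      obtain ⟨h₃, h₂, h₁⟩ := subdiscriminants_pos hx hFx
      rcases hL with hL | hL | hL <;> linarith
    obtain ⟨G, hG, hGd, hFG⟩ := hF.exists_eq_quadratic_mul (hroot i) hi hFd
    rw [hFf] at hFG
    rcases hG.cubic_eq hGd with ⟨a, b, c, h⟩ | ⟨a, w, hw, h⟩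
    · have hv : f = ∏ k, (X - C ((![z i, (starRingEnd ℂ) (z i), (a : ℂ), (b : ℂ), (c : ℂ)] :
          Fin 5 → ℂ) k)) := by
        rw [hFG, h, Fin.prod_univ_five]
        simp [mul_assoc]
      rw [← prod_sub_sq_eq_of_prod_X_sub_C_eq (hv.symm.trans hf), prod_sub_sq_one_conj_pair,
        Complex.ofReal_inj] at hD
      rw [hD] at hpos
      exact absurd hpos (not_lt.2 (neg_nonpos.2 (sq_nonneg _)))
    · have hv : f = (X - C (a : ℂ)) * (X - C (z i)) * (X - C ((starRingEnd ℂ) (z i))) *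
          (X - C w) * (X - C ((starRingEnd ℂ) w)) := by
        rw [hFG, h]
        ring
      have hv' : f = ∏ k, (X - C ((![(a : ℂ), z i, (starRingEnd ℂ) (z i), w,
          (starRingEnd ℂ) w] : Fin 5 → ℂ) k)) := by
        rw [hv, Fin.prod_univ_five]
        rfl
      rw [← prod_sub_sq_eq_of_prod_X_sub_C_eq (hv'.symm.trans hf), prod_sub_sq_five] at hD
      have hne := hpos.ne'
      rw [← Complex.ofReal_ne_zero, hD] at hne
      simp only [Matrix.cons_val, ne_eq, pow_eq_zero_iff, mul_eq_zero, OfNat.ofNat_ne_zero,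
        not_false_eq_true, not_or, sub_eq_zero] at hne
      exact ⟨a, z i, w, hi, hw, by tauto, by tauto, by tauto, by tauto, by tauto, by tauto, hv⟩
end
end

section
/- The monic quintic f has one real double root and three distinct real simple roots — i.e., there exist real numbers a, b1, b2, b3, pairwise distinct, with f(X) = (X−a)^2(X−b1)(X−b2)(X−b3) — if and only if D = 0 and L1 > 0. -/
open Polynomial

noncomputable section

theorem quintic_eq_iff {R : Type*} [CommRing R] (p q r s t p' q' r' s' t' : R) :
    (X ^ 5 + C p * X ^ 4 + C q * X ^ 3 + C r * X ^ 2 + C s * X + C t : Polynomial R) =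
        X ^ 5 + C p' * X ^ 4 + C q' * X ^ 3 + C r' * X ^ 2 + C s' * X + C t' ↔
      p = p' ∧ q = q' ∧ r = r' ∧ s = s' ∧ t = t' := by
  constructor
  · intro h
    have coeff_eq (n : ℕ) := congrArg (fun f : Polynomial R => f.coeff n) h
    refine ⟨?_, ?_, ?_, ?_, ?_⟩
    · simpa [coeff_X, coeff_C, coeff_X_pow] using coeff_eq 4
    · simpa [coeff_X, coeff_C, coeff_X_pow] using coeff_eq 3
    · simpa [coeff_X, coeff_C, coeff_X_pow] using coeff_eq 2
    · simpa [coeff_X, coeff_C, coeff_X_pow] using coeff_eq 1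
    · simpa [coeff_X, coeff_C, coeff_X_pow] using coeff_eq 0
  · rintro ⟨rfl, rfl, rfl, rfl, rfl⟩
    rfl

theorem quintic_eq_sq_mul_iff {R : Type*} [CommRing R] (p q r s t a b c d : R) :
    (X ^ 5 + C p * X ^ 4 + C q * X ^ 3 + C r * X ^ 2 + C s * X + C t : Polynomial R) =
        (X - C a) ^ 2 * (X - C b) * (X - C c) * (X - C d) ↔
      p = -(2 * a + b + c + d) ∧
      q = a ^ 2 + 2 * a * (b + c + d) + (b * c + b * d + c * d) ∧
      r = -(a ^ 2 * (b + c + d) + 2 * a * (b * c + b * d + c * d) + b * c * d) ∧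
      s = a ^ 2 * (b * c + b * d + c * d) + 2 * a * (b * c * d) ∧
      t = -(a ^ 2 * (b * c * d)) := by
  have expand : ((X - C a) ^ 2 * (X - C b) * (X - C c) * (X - C d) : Polynomial R) =
      X ^ 5 + C (-(2 * a + b + c + d)) * X ^ 4 +
        C (a ^ 2 + 2 * a * (b + c + d) + (b * c + b * d + c * d)) * X ^ 3 +
        C (-(a ^ 2 * (b + c + d) + 2 * a * (b * c + b * d + c * d) + b * c * d)) * X ^ 2 +
        C (a ^ 2 * (b * c + b * d + c * d) + 2 * a * (b * c * d)) * X +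
        C (-(a ^ 2 * (b * c * d))) := by
    simp only [map_add, map_mul, map_neg, map_pow, map_ofNat]
    ring
  rw [expand, quintic_eq_iff]

theorem quinticL1_eq_of_double_root {p q r s t : ℝ} {a b c d : ℂ}
    (h : (X ^ 5 + C (p : ℂ) * X ^ 4 + C (q : ℂ) * X ^ 3 + C (r : ℂ) * X ^ 2 + C (s : ℂ) * X +
        C (t : ℂ) : Polynomial ℂ) = (X - C a) ^ 2 * (X - C b) * (X - C c) * (X - C d)) :
    (quinticL1 p q r s t : ℂ) =
      2 * ((a - b) * (a - c) * (a - d) * (b - c) * (b - d) * (c - d)) ^ 2 := by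
  obtain ⟨hp, hq, hr, hs, ht⟩ := (quintic_eq_sq_mul_iff _ _ _ _ _ _ _ _ _).1 h
  simp only [quinticL1]
  push_cast
  rw [hp, hq, hr, hs, ht]
  ring

open scoped ComplexConjugate

theorem quintic_roots_conj {p q r s t : ℝ} {a b c d : ℂ}
    (h : (X ^ 5 + C (p : ℂ) * X ^ 4 + C (q : ℂ) * X ^ 3 + C (r : ℂ) * X ^ 2 + C (s : ℂ) * X +
        C (t : ℂ) : Polynomial ℂ) = (X - C a) ^ 2 * (X - C b) * (X - C c) * (X - C d)) :
    (X - C (conj a)) ^ 2 * (X - C (conj b)) * (X - C (conj c)) * (X - C (conj d)) =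
      (X - C a) ^ 2 * (X - C b) * (X - C c) * (X - C d) := by
  have hc := congrArg (Polynomial.map (starRingEnd ℂ)) h
  simp only [Polynomial.map_add, Polynomial.map_mul, Polynomial.map_pow, Polynomial.map_sub,
    map_X, map_C, Complex.conj_ofReal] at hc
  rw [← hc, h]

theorem Complex.sq_re_nonpos_of_conj_eq_neg {e : ℂ} (h : conj e = -e) : (e ^ 2).re ≤ 0 := by
  have hre : e.re = 0 := by
    have := congrArg Complex.re h
    simp only [Complex.conj_re, Complex.neg_re] at this
    linarith
  simp only [sq, Complex.mul_re, hre]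
  nlinarith [mul_self_nonneg e.im]

theorem conj_eq_self_of_sq_mul_eq {a b c d : ℂ} (hab : a ≠ b) (hac : a ≠ c) (had : a ≠ d)
    (hbc : b ≠ c) (hbd : b ≠ d) (hcd : c ≠ d)
    (h : (X - C (conj a)) ^ 2 * (X - C (conj b)) * (X - C (conj c)) * (X - C (conj d)) =
      (X - C a) ^ 2 * (X - C b) * (X - C c) * (X - C d)) :
    conj a = a := by
  have he := congrArg (eval (conj a)) h
  have hd := congrArg (fun f => eval (conj a) (derivative f)) h
  simp only [derivative_mul, derivative_pow, derivative_sub, derivative_X, derivative_C,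
    eval_add, eval_mul, eval_pow, eval_sub, eval_X, eval_C, sub_self,
    eval_one, eval_zero] at he hd
  norm_num at he hd
  rcases he with ((he | he) | he) | he
  · exact sub_eq_zero.1 he
  all_goals
    rw [sub_eq_zero.1 he] at hd
    simp [sub_eq_zero, hbc, hbd, hcd, hab.symm, hac.symm, had.symm, hbc.symm,
      hbd.symm, hcd.symm] at hd

theorem exists_real_roots_of_double_root {p q r s t : ℝ} {a b c d : ℂ}
    (h : (X ^ 5 + C (p : ℂ) * X ^ 4 + C (q : ℂ) * X ^ 3 + C (r : ℂ) * X ^ 2 + C (s : ℂ) * X +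
        C (t : ℂ) : Polynomial ℂ) = (X - C a) ^ 2 * (X - C b) * (X - C c) * (X - C d))
    (hL : 0 < quinticL1 p q r s t) :
    ∃ a b1 b2 b3 : ℝ, a ≠ b1 ∧ a ≠ b2 ∧ a ≠ b3 ∧ b1 ≠ b2 ∧ b1 ≠ b3 ∧ b2 ≠ b3 ∧
      (X ^ 5 + C p * X ^ 4 + C q * X ^ 3 + C r * X ^ 2 + C s * X + C t : Polynomial ℝ) =
        (X - C a) ^ 2 * (X - C b1) * (X - C b2) * (X - C b3) := by
  have hE := quinticL1_eq_of_double_root h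
  have hne : 2 * ((a - b) * (a - c) * (a - d) * (b - c) * (b - d) * (c - d)) ^ 2 ≠ 0 := by
    rw [← hE]
    exact_mod_cast hL.ne'
  have hconj : conj ((a - b) * (a - c) * (a - d) * (b - c) * (b - d) * (c - d)) ≠
      -((a - b) * (a - c) * (a - d) * (b - c) * (b - d) * (c - d)) := by
    intro hneg
    have hle := Complex.sq_re_nonpos_of_conj_eq_neg hneg
    have hre := congrArg Complex.re hE
    rw [Complex.ofReal_re, Complex.mul_re, Complex.re_ofNat, Complex.im_ofNat, zero_mul,
      sub_zero] at hre
    linarith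
  simp only [ne_eq, mul_eq_zero, pow_eq_zero_iff, OfNat.ofNat_ne_zero, not_false_eq_true,
    not_or, sub_eq_zero, false_or] at hne
  obtain ⟨⟨⟨⟨⟨hab, hac⟩, had⟩, hbc⟩, hbd⟩, hcd⟩ := hne
  have hroots := quintic_roots_conj h
  have ha : conj a = a := conj_eq_self_of_sq_mul_eq hab hac had hbc hbd hcd hroots
  have hinj (x y : ℂ) (hxy : conj x = conj y) : x = y := (starRingEnd ℂ).injective hxy
  have hb : conj b = b ∨ conj b = c ∨ conj b = d := by
    have := congrArg (eval (conj b)) hroots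
    have hba : conj b ≠ a := fun e => hab (hinj _ _ (ha.trans e.symm))
    simpa [sub_eq_zero, hba, or_assoc] using this.symm
  have hc : conj c = b ∨ conj c = c ∨ conj c = d := by
    have := congrArg (eval (conj c)) hroots
    have hca : conj c ≠ a := fun e => hac (hinj _ _ (ha.trans e.symm))
    simpa [sub_eq_zero, hca, or_assoc] using this.symm
  have hd : conj d = b ∨ conj d = c ∨ conj d = d := by
    have := congrArg (eval (conj d)) hroots
    have hda : conj d ≠ a := fun e => had (hinj _ _ (ha.trans e.symm))
    simpa [sub_eq_zero, hda, or_assoc] using this.symm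
  have hreal : conj b = b ∧ conj c = c ∧ conj d = d := by
    simp only [map_mul, map_sub, ha] at hconj
    have hbb := Complex.conj_conj b
    have hcc := Complex.conj_conj c
    have hdd := Complex.conj_conj d
    clear hroots hinj hE hL h
    rcases hb with hb | hb | hb <;> rcases hc with hc | hc | hc <;>
      rcases hd with hd | hd | hd <;> rw [hb] at hbb hconj <;> rw [hc] at hcc hconj <;>
      rw [hd] at hdd hconj <;>
      first
      | exact ⟨hb, hc, hd⟩
      | (refine absurd ?_ hconj; ring1)
      | simp_all
  clear hb hc hd
  obtain ⟨hb, hc, hd⟩ := hreal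
  obtain ⟨a, rfl⟩ := Complex.conj_eq_iff_real.1 ha
  obtain ⟨b, rfl⟩ := Complex.conj_eq_iff_real.1 hb
  obtain ⟨c, rfl⟩ := Complex.conj_eq_iff_real.1 hc
  obtain ⟨d, rfl⟩ := Complex.conj_eq_iff_real.1 hd
  norm_cast at hab hac had hbc hbd hcd
  refine ⟨a, b, c, d, hab, hac, had, hbc, hbd, hcd, ?_⟩
  rw [quintic_eq_sq_mul_iff] at h ⊢
  exact_mod_cast h

theorem not_injective_of_sq_dvd_prod {K ι : Type*} [Field K] [Fintype ι] {z : ι → K} {a : K}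
    (h : (X - C a) ^ 2 ∣ ∏ i, (X - C (z i))) : ¬ Function.Injective z := by
  intro hz
  have hsq := (separable_prod_X_sub_C_iff.2 hz).squarefree
  exact not_isUnit_X_sub_C a (hsq _ (sq (X - C a) ▸ h))

theorem quintic_one_double_three_single (p q r s t D : ℝ) (z : Fin 5 → ℂ)
    (hf : (X ^ 5 + C (p : ℂ) * X ^ 4 + C (q : ℂ) * X ^ 3 + C (r : ℂ) * X ^ 2 + C (s : ℂ) * X + C (t : ℂ) : Polynomial ℂ) = ∏ i : Fin 5, (X - C (z i)))
    (hD : (D : ℂ) = ∏ i : Fin 5, ∏ j ∈ Finset.Ioi i, (z i - z j) ^ 2) :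
    (∃ a b1 b2 b3 : ℝ, a ≠ b1 ∧ a ≠ b2 ∧ a ≠ b3 ∧ b1 ≠ b2 ∧ b1 ≠ b3 ∧ b2 ≠ b3 ∧
      (X ^ 5 + C p * X ^ 4 + C q * X ^ 3 + C r * X ^ 2 + C s * X + C t : Polynomial ℝ) =
        (X - C a) ^ 2 * (X - C b1) * (X - C b2) * (X - C b3)) ↔
    (D = 0 ∧ 0 < quinticL1 p q r s t) := by
  constructor
  · rintro ⟨a, b, c, d, hab, hac, had, hbc, hbd, hcd, h⟩
    have hC : (X ^ 5 + C (p : ℂ) * X ^ 4 + C (q : ℂ) * X ^ 3 + C (r : ℂ) * X ^ 2 + C (s : ℂ) * X +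
        C (t : ℂ) : Polynomial ℂ) =
        (X - C (a : ℂ)) ^ 2 * (X - C (b : ℂ)) * (X - C (c : ℂ)) * (X - C (d : ℂ)) := by
      rw [quintic_eq_sq_mul_iff] at h ⊢
      exact_mod_cast h
    constructor
    · have hz : ¬ Function.Injective z := not_injective_of_sq_dvd_prod (a := (a : ℂ)) <| by
        rw [← hf, hC, mul_assoc, mul_assoc]
        exact dvd_mul_right _ _
      obtain ⟨i, j, hij, hne⟩ := Function.not_injective_iff.1 hz
      wlog hlt : i < j generalizing i j
      · exact this j i hij.symm hne.symm (lt_of_le_of_ne (not_lt.1 hlt) hne.symm)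
      have hD0 : (D : ℂ) = 0 := by
        rw [hD]
        refine Finset.prod_eq_zero (Finset.mem_univ i)
          (Finset.prod_eq_zero (Finset.mem_Ioi.2 hlt) ?_)
        simp [hij]
      exact_mod_cast hD0
    · have hL : quinticL1 p q r s t =
          2 * ((a - b) * (a - c) * (a - d) * (b - c) * (b - d) * (c - d)) ^ 2 := by
        exact_mod_cast quinticL1_eq_of_double_root hC
      rw [hL]
      have := sub_ne_zero.2 hab
      have := sub_ne_zero.2 hac
      have := sub_ne_zero.2 had
      have := sub_ne_zero.2 hbc
      have := sub_ne_zero.2 hbd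
      have := sub_ne_zero.2 hcd
      positivity
  · rintro ⟨rfl, hL⟩
    obtain ⟨i, -, hi⟩ := Finset.prod_eq_zero_iff.1 (hD.symm.trans Complex.ofReal_zero)
    obtain ⟨j, hj, hij⟩ := Finset.prod_eq_zero_iff.1 hi
    have hlt := Finset.mem_Ioi.1 hj
    have heq : z i = z j := sub_eq_zero.1 (pow_eq_zero_iff two_ne_zero |>.1 hij)
    obtain ⟨a, b, c, d, h⟩ : ∃ a b c d : ℂ, ∏ i : Fin 5, (X - C (z i)) =
        (X - C a) ^ 2 * (X - C b) * (X - C c) * (X - C d) := by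
      rw [Fin.prod_univ_five]
      clear hf hD hi hij hj
      fin_cases i <;> fin_cases j <;> simp at hlt heq
      · exact ⟨z 0, z 2, z 3, z 4, by rw [← heq]; ring⟩
      · exact ⟨z 0, z 1, z 3, z 4, by rw [← heq]; ring⟩
      · exact ⟨z 0, z 1, z 2, z 4, by rw [← heq]; ring⟩
      · exact ⟨z 0, z 1, z 2, z 3, by rw [← heq]; ring⟩
      · exact ⟨z 1, z 0, z 3, z 4, by rw [← heq]; ring⟩
      · exact ⟨z 1, z 0, z 2, z 4, by rw [← heq]; ring⟩
      · exact ⟨z 1, z 0, z 2, z 3, by rw [← heq]; ring⟩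
      · exact ⟨z 2, z 0, z 1, z 4, by rw [← heq]; ring⟩
      · exact ⟨z 2, z 0, z 1, z 3, by rw [← heq]; ring⟩
      · exact ⟨z 3, z 0, z 1, z 2, by rw [← heq]; ring⟩
    exact exists_real_roots_of_double_root (hf.trans h) hL
end
end

section
/- The monic quintic f has one real quadruple root and one real simple root — i.e., there exist distinct real numbers a and b with f(X) = (X−a)^4(X−b) — if and only if D = 0, L1 = 0, L2 = 0, L3 ≠ 0 and M1 = 0. -/
open Polynomial

noncomputable section

def quinticM1 (p q r s : ℝ) : ℝ := 8*p^3*r - 80*p^2*s - 3*p^2*q^2 + 10*p*q*r + 200*q*s - 75*r^2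

/-- The coefficients of a quintic with a quadruple root `a` and a further root `b`. -/
theorem quintic_eq_quadruple_mul_iff (p q r s t a b : ℝ) :
    (X ^ 5 + C p * X ^ 4 + C q * X ^ 3 + C r * X ^ 2 + C s * X + C t : Polynomial ℝ) =
        (X - C a) ^ 4 * (X - C b) ↔
      p = -(4 * a + b) ∧ q = 6 * a ^ 2 + 4 * a * b ∧ r = -(4 * a ^ 3 + 6 * a ^ 2 * b) ∧
        s = a ^ 4 + 4 * a ^ 3 * b ∧ t = -(a ^ 4 * b) := by
  constructor
  · intro h
    have h0 := congrArg (eval 0) h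
    have h1 := congrArg (eval 1) h
    have h2 := congrArg (eval (-1)) h
    have h3 := congrArg (eval 2) h
    have h4 := congrArg (eval (-2)) h
    simp only [eval_add, eval_sub, eval_mul, eval_pow, eval_X, eval_C] at h0 h1 h2 h3 h4
    refine ⟨?_, ?_, ?_, ?_, ?_⟩ <;> linarith
  · rintro ⟨rfl, rfl, rfl, rfl, rfl⟩
    simp only [C_add, C_mul, C_pow, C_neg, map_ofNat]
    ring

/-- If a product of linear factors has a multiple root, two of the roots coincide, so that the
product of the squared root differences vanishes. -/
theorem prod_sq_sub_eq_zero_of_sq_dvd {n : ℕ} (z : Fin n → ℂ) (a : ℂ)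
    (h : (X - C a) ^ 2 ∣ ∏ i, (X - C (z i))) :
    ∏ i : Fin n, ∏ j ∈ Finset.Ioi i, (z i - z j) ^ 2 = 0 := by
  have hz : ¬ Function.Injective z := fun hinj => by
    have hsq := (separable_prod_X_sub_C_iff.mpr hinj).squarefree
    exact not_isUnit_X_sub_C a (hsq _ (by rwa [← sq]))
  obtain ⟨i, j, hij, hne⟩ := Function.not_injective_iff.mp hz
  wlog hlt : i < j generalizing i j
  · exact this j i hij.symm hne.symm (lt_of_le_of_ne (not_lt.mp hlt) hne.symm)
  exact Finset.prod_eq_zero (Finset.mem_univ i)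
    (Finset.prod_eq_zero (Finset.mem_Ioi.mpr hlt) (by simp [hij]))

/-- The depressed case of the criterion: the quintic `X^5 + q X^3 + r X^2 + s X + t` is
`(X - a)^4 (X + 4a)`. -/
theorem depressed_quintic_coeffs {q r s t : ℝ} (hL1 : quinticL1 0 q r s t = 0)
    (hL2 : quinticL2 0 q r s = 0) (hL3 : quinticL3 0 q ≠ 0) (hM1 : quinticM1 0 q r s = 0) :
    ∃ a : ℝ, a ≠ 0 ∧ q = -10 * a ^ 2 ∧ r = 20 * a ^ 3 ∧ s = -15 * a ^ 4 ∧ t = 4 * a ^ 5 := by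
  simp only [quinticL1, quinticL2, quinticL3, quinticM1] at *
  have hq : q ≠ 0 := by
    rintro rfl
    simp at hL3
  obtain ⟨a, rfl⟩ : ∃ a, r = -2 * q * a := ⟨-r / (2 * q), by field_simp⟩
  have hqa : q = -10 * a ^ 2 := mul_left_cancel₀ (pow_ne_zero 2 hq)
    (by linear_combination (hM1 - 5 * hL2) / 60)
  have ha : a ≠ 0 := by
    rintro rfl
    simp [hqa] at hq
  have hs : s = -15 * a ^ 4 := mul_left_cancel₀ hq
    (by rw [hqa] at hM1 ⊢; linear_combination hM1 / 200)
  subst hqa hs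
  have ht : a ^ 2 * (t - 4 * a ^ 5) ^ 2 = 0 := by linear_combination -hL1 / 2500
  have ht' : t - 4 * a ^ 5 = 0 := by simpa [ha] using ht
  exact ⟨a, ha, rfl, by ring, rfl, by linear_combination ht'⟩

theorem quintic_quadruple_and_single (p q r s t D : ℝ) (z : Fin 5 → ℂ)
    (hf : (X ^ 5 + C (p : ℂ) * X ^ 4 + C (q : ℂ) * X ^ 3 + C (r : ℂ) * X ^ 2 + C (s : ℂ) * X + C (t : ℂ) : Polynomial ℂ) = ∏ i : Fin 5, (X - C (z i)))
    (hD : (D : ℂ) = ∏ i : Fin 5, ∏ j ∈ Finset.Ioi i, (z i - z j) ^ 2) :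
    (∃ a b : ℝ, a ≠ b ∧
      (X ^ 5 + C p * X ^ 4 + C q * X ^ 3 + C r * X ^ 2 + C s * X + C t : Polynomial ℝ) = (X - C a) ^ 4 * (X - C b)) ↔
    (D = 0 ∧ quinticL1 p q r s t = 0 ∧ quinticL2 p q r s = 0 ∧ quinticL3 p q ≠ 0 ∧
      quinticM1 p q r s = 0) := by
  simp only [quintic_eq_quadruple_mul_iff]
  constructor
  · rintro ⟨a, b, hab, rfl, rfl, rfl, rfl, rfl⟩
    refine ⟨?_, ?_, ?_, ?_, ?_⟩
    · rw [← Complex.ofReal_eq_zero, hD]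
      refine prod_sq_sub_eq_zero_of_sq_dvd z a (hf ▸ ⟨(X - C (a : ℂ)) ^ 2 * (X - C (b : ℂ)), ?_⟩)
      push_cast
      simp only [C_add, C_mul, C_pow, C_neg, map_ofNat]
      ring
    · simp only [quinticL1]; ring
    · simp only [quinticL2]; ring
    · have h : quinticL3 (-(4 * a + b)) (6 * a ^ 2 + 4 * a * b) = 2 * (a - b) ^ 2 := by
        simp only [quinticL3]; ring
      rw [h]
      exact mul_ne_zero two_ne_zero (pow_ne_zero 2 (sub_ne_zero.mpr hab))
    · simp only [quinticM1]; ring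
  · rintro ⟨-, hL1, hL2, hL3, hM1⟩
    obtain ⟨c, rfl⟩ : ∃ c, p = 5 * c := ⟨p / 5, by ring⟩
    obtain ⟨q, rfl⟩ : ∃ q', q = q' + 10 * c ^ 2 := ⟨q - 10 * c ^ 2, by ring⟩
    obtain ⟨r, rfl⟩ : ∃ r', r = r' + (10 * c ^ 3 + 3 * q * c) :=
      ⟨r - (10 * c ^ 3 + 3 * q * c), by ring⟩
    obtain ⟨s, rfl⟩ : ∃ s', s = s' + (5 * c ^ 4 + 3 * q * c ^ 2 + 2 * r * c) :=
      ⟨s - (5 * c ^ 4 + 3 * q * c ^ 2 + 2 * r * c), by ring⟩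
    obtain ⟨t, rfl⟩ : ∃ t', t = t' + (c ^ 5 + q * c ^ 3 + r * c ^ 2 + s * c) :=
      ⟨t - (c ^ 5 + q * c ^ 3 + r * c ^ 2 + s * c), by ring⟩
    obtain ⟨a, ha, rfl, rfl, rfl, rfl⟩ := depressed_quintic_coeffs (q := q) (r := r) (s := s)
      (t := t) (.trans (by simp only [quinticL1]; ring) hL1)
      (.trans (by simp only [quinticL2]; ring) hL2)
      (by convert hL3 using 1; simp only [quinticL3]; ring)
      (.trans (by simp only [quinticM1]; ring) hM1)
    refine ⟨a - c, -4 * a - c, fun h => ha (by linarith), ?_, ?_, ?_, ?_, ?_⟩ <;> ring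
end
end

section
/- The monic quintic f has a quintuple root — i.e., there exists a real number a with f(X) = (X−a)^5 — if and only if D = 0, L1 = 0, L2 = 0 and L3 = 0. -/
open Polynomial

noncomputable section

theorem eq_zero_of_shifted_pow_five_add_const {z : Fin 5 → ℂ} {b c : ℂ}
    (hf : ((X + C b) ^ 5 + C c : Polynomial ℂ) = ∏ i : Fin 5, (X - C (z i)))
    {i j : Fin 5} (hij : i ≠ j) (hz : z i = z j) : c = 0 := by
  obtain ⟨g, hg⟩ : (X - C (z i)) * (X - C (z i)) ∣ ∏ i : Fin 5, (X - C (z i)) := by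
    rw [← Finset.mul_prod_erase _ _ (Finset.mem_univ i),
      ← Finset.mul_prod_erase _ _ (Finset.mem_erase.mpr ⟨hij.symm, Finset.mem_univ j⟩),
      ← mul_assoc, ← hz]
    exact dvd_mul_right _ _
  rw [hg] at hf
  have hroot := congrArg (eval (z i)) hf
  have hderiv := congrArg (fun u => eval (z i) (derivative u)) hf
  simp [derivative_pow] at hroot hderiv
  simpa [hderiv] using hroot

theorem coeffs_of_quintic_eq_pow {p q r s t a : ℝ}
    (h : (X ^ 5 + C p * X ^ 4 + C q * X ^ 3 + C r * X ^ 2 + C s * X + C t : Polynomial ℝ)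
      = (X - C a) ^ 5) :
    p = -5 * a ∧ q = 10 * a ^ 2 ∧ r = -10 * a ^ 3 ∧ s = 5 * a ^ 4 ∧ t = -a ^ 5 := by
  have e (x : ℝ) : x ^ 5 + p * x ^ 4 + q * x ^ 3 + r * x ^ 2 + s * x + t = (x - a) ^ 5 := by
    simpa using congrArg (eval x) h
  have h0 := e 0
  have h1 := e 1
  have h2 := e (-1)
  have h3 := e 2
  have h4 := e (-2)
  ring_nf at h0 h1 h2 h3 h4
  refine ⟨?_, ?_, ?_, ?_, ?_⟩ <;> linarith

theorem quintic_quintuple_root (p q r s t D : ℝ) (z : Fin 5 → ℂ)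
    (hf : (X ^ 5 + C (p : ℂ) * X ^ 4 + C (q : ℂ) * X ^ 3 + C (r : ℂ) * X ^ 2 + C (s : ℂ) * X + C (t : ℂ) : Polynomial ℂ) = ∏ i : Fin 5, (X - C (z i)))
    (hD : (D : ℂ) = ∏ i : Fin 5, ∏ j ∈ Finset.Ioi i, (z i - z j) ^ 2) :
    (∃ a : ℝ, (X ^ 5 + C p * X ^ 4 + C q * X ^ 3 + C r * X ^ 2 + C s * X + C t : Polynomial ℝ) = (X - C a) ^ 5) ↔
    (D = 0 ∧ quinticL1 p q r s t = 0 ∧ quinticL2 p q r s = 0 ∧ quinticL3 p q = 0) := by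
  constructor
  · rintro ⟨a, ha⟩
    obtain ⟨rfl, rfl, rfl, rfl, rfl⟩ := coeffs_of_quintic_eq_pow ha
    have hz (i : Fin 5) : z i = a := by
      have h := congrArg (eval (z i)) hf
      rw [eval_prod, Finset.prod_eq_zero (Finset.mem_univ i) (by simp)] at h
      have h5 : (z i - a) ^ 5 = 0 := by
        rw [← h]
        simp
        ring
      exact sub_eq_zero.mp (pow_eq_zero_iff (by norm_num) |>.mp h5)
    refine ⟨?_, ?_, ?_, ?_⟩
    · have h0 : (D : ℂ) = 0 := by
        rw [hD]
        refine Finset.prod_eq_zero (Finset.mem_univ 0) ?_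
        exact Finset.prod_eq_zero (i := 1) (by simp) (by simp [hz])
      exact_mod_cast h0
    · unfold quinticL1; ring
    · unfold quinticL2; ring
    · unfold quinticL3; ring
  · rintro ⟨rfl, h1, h2, h3⟩
    obtain ⟨b, rfl⟩ : ∃ b, p = 5 * b := ⟨p / 5, by ring⟩
    obtain rfl : q = 10 * b ^ 2 := by
      unfold quinticL3 at h3; linarith
    obtain rfl : r = 10 * b ^ 3 := by
      have h : (r - 10 * b ^ 3) ^ 2 = 0 := by
        unfold quinticL2 at h2; linarith
      exact sub_eq_zero.mp (pow_eq_zero_iff (by norm_num) |>.mp h)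
    obtain rfl : s = 5 * b ^ 4 := by
      have h : (s - 5 * b ^ 4) ^ 3 = 0 := by
        unfold quinticL1 at h1; linarith
      exact sub_eq_zero.mp (pow_eq_zero_iff (by norm_num) |>.mp h)
    obtain ⟨i, -, hi⟩ := Finset.prod_eq_zero_iff.mp (hD.symm.trans Complex.ofReal_zero)
    obtain ⟨j, hj, hij⟩ := Finset.prod_eq_zero_iff.mp hi
    have hz : z i = z j := sub_eq_zero.mp (pow_eq_zero_iff (by norm_num) |>.mp hij)
    have hc : ((t - b ^ 5 : ℝ) : ℂ) = 0 := by
      refine eq_zero_of_shifted_pow_five_add_const (b := b) ?_ (Finset.mem_Ioi.mp hj).ne hz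
      rw [← hf]
      simp only [Complex.ofReal_mul, Complex.ofReal_pow, Complex.ofReal_sub, Complex.ofReal_ofNat,
        map_mul, map_pow, map_sub, map_ofNat]
      ring
    obtain rfl : t = b ^ 5 := sub_eq_zero.mp (Complex.ofReal_eq_zero.mp hc)
    refine ⟨-b, ?_⟩
    simp only [map_mul, map_pow, map_neg, map_ofNat]
    ring
end
end

section
/- Suppose the monic quintic f factors as f(X) = (X−a)^4(X−b) with a, b real and a ≠ b. Then 2p^2 − 5q ≠ 0, the quadruple root satisfies a = (5r − pq) / (2(2p^2 − 5q)), and b − a = −(4p^3 − 15pq + 25r) / (2(2p^2 − 5q)); consequently a < b (the quadruple root is less than the simple root) if and only if (4p^3 − 15pq + 25r) / (2p^2 − 5q) < 0. -/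
open Polynomial

noncomputable section

theorem coeff_of_eq_X_sub_C_pow_four_mul {R : Type*} [CommRing R] {p q r s t a b : R}
    (hf : (X ^ 5 + C p * X ^ 4 + C q * X ^ 3 + C r * X ^ 2 + C s * X + C t : Polynomial R) =
      (X - C a) ^ 4 * (X - C b)) :
    p = -(4 * a + b) ∧ q = 6 * a ^ 2 + 4 * a * b ∧ r = -(4 * a ^ 3 + 6 * a ^ 2 * b) := by
  have expand : (X - C a) ^ 4 * (X - C b) =
      X ^ 5 + C (-(4 * a + b)) * X ^ 4 + C (6 * a ^ 2 + 4 * a * b) * X ^ 3 +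
        C (-(4 * a ^ 3 + 6 * a ^ 2 * b)) * X ^ 2 + C (a ^ 4 + 4 * a ^ 3 * b) * X +
        C (-(a ^ 4 * b)) := by
    simp only [map_neg, map_add, map_mul, map_pow, map_ofNat]
    ring
  rw [expand] at hf
  have hcoeff (n : ℕ) := congrArg (fun g => coeff g n) hf
  simp only [coeff_add, coeff_C_mul, coeff_X_pow, coeff_X, coeff_C] at hcoeff
  exact ⟨by simpa using hcoeff 4, by simpa using hcoeff 3, by simpa using hcoeff 2⟩

theorem quadruple_root_position (p q r s t a b : ℝ) (hab : a ≠ b)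
    (hf : (X ^ 5 + C p * X ^ 4 + C q * X ^ 3 + C r * X ^ 2 + C s * X + C t : Polynomial ℝ) = (X - C a) ^ 4 * (X - C b)) :
    2 * p ^ 2 - 5 * q ≠ 0 ∧
    a = (5 * r - p * q) / (2 * (2 * p ^ 2 - 5 * q)) ∧
    b - a = -(4 * p ^ 3 - 15 * p * q + 25 * r) / (2 * (2 * p ^ 2 - 5 * q)) ∧
    (a < b ↔ (4 * p ^ 3 - 15 * p * q + 25 * r) / (2 * p ^ 2 - 5 * q) < 0) := by
  obtain ⟨rfl, rfl, rfl⟩ := coeff_of_eq_X_sub_C_pow_four_mul hf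
  have hd : a - b ≠ 0 := sub_ne_zero.mpr hab
  have hden : 2 * (-(4 * a + b)) ^ 2 - 5 * (6 * a ^ 2 + 4 * a * b) = 2 * (a - b) ^ 2 := by ring
  have hnum : 4 * (-(4 * a + b)) ^ 3 - 15 * -(4 * a + b) * (6 * a ^ 2 + 4 * a * b) +
      25 * -(4 * a ^ 3 + 6 * a ^ 2 * b) = 4 * (a - b) ^ 3 := by ring
  have hquot : 4 * (a - b) ^ 3 / (2 * (a - b) ^ 2) = 2 * (a - b) := by
    field_simp
    norm_num
  rw [hden, hnum, hquot]
  refine ⟨by positivity, ?_, ?_, ?_⟩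
  · rw [eq_div_iff (by positivity)]
    ring
  · rw [eq_div_iff (by positivity)]
    ring
  · constructor <;> intro h <;> linarith
end
end

section
/- Let g(x) = x^3 + a·x^2 + b·x + c be a monic cubic with real coefficients having three distinct real roots, none of which is zero (so c ≠ 0). Then: (i) all three roots are negative if and only if b > 0, c > 0 and ab − 9c > 0; (ii) all three roots are positive if and only if b > 0, c < 0 and ab − 9c < 0; (iii) if neither the condition in (i) nor the condition in (ii) holds, then g has exactly two positive roots when c > 0 and exactly one positive root when c < 0. -/
open Polynomial

noncomputable section

/-- The strict inequality `9 e₃ < e₁ e₂` between the elementary symmetric functions of three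
positive reals that are not all equal. -/
theorem nine_mul_esymm_three_lt {p q r : ℝ} (hp : 0 < p) (hq : 0 < q) (hr : 0 < r) (hpq : p ≠ q) :
    9 * (p * q * r) < (p + q + r) * (p * q + q * r + r * p) := by
  have h₁ : 0 < r * (p - q) ^ 2 := mul_pos hr (sq_pos_of_ne_zero (sub_ne_zero.mpr hpq))
  have h₂ : 0 ≤ p * (q - r) ^ 2 := by positivity
  have h₃ : 0 ≤ q * (r - p) ^ 2 := by positivity
  linarith

/-- A real number is positive if it is a root of a monic cubic whose coefficients strictly
alternate in sign. -/
theorem pos_of_cubic_eq_zero {s t u p : ℝ} (hs : 0 < s) (ht : 0 < t) (hu : 0 < u)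
    (h : p ^ 3 - s * p ^ 2 + t * p - u = 0) : 0 < p := by
  by_contra! hp
  have h₁ : p ^ 3 ≤ 0 := Odd.pow_nonpos (by decide) hp
  have h₂ : 0 ≤ s * p ^ 2 := by positivity
  have h₃ : t * p ≤ 0 := mul_nonpos_of_nonneg_of_nonpos ht.le hp
  linarith

theorem all_pos_iff_esymm {p q r : ℝ} (hpq : p ≠ q) :
    (0 < p ∧ 0 < q ∧ 0 < r) ↔
      0 < p * q + q * r + r * p ∧ 0 < p * q * r ∧
        9 * (p * q * r) < (p + q + r) * (p * q + q * r + r * p) := by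
  constructor
  · rintro ⟨hp, hq, hr⟩
    exact ⟨by positivity, by positivity, nine_mul_esymm_three_lt hp hq hr hpq⟩
  · rintro ⟨h₂, h₃, h⟩
    have h₁ : 0 < p + q + r := pos_of_mul_pos_left (by linarith) h₂.le
    exact ⟨pos_of_cubic_eq_zero h₁ h₂ h₃ (by ring), pos_of_cubic_eq_zero h₁ h₂ h₃ (by ring),
      pos_of_cubic_eq_zero h₁ h₂ h₃ (by ring)⟩

theorem cubic_coeff_eq_of_eq_prod {a b c : ℝ} {x : Fin 3 → ℝ}
    (hf : (X ^ 3 + C a * X ^ 2 + C b * X + C c : Polynomial ℝ) = ∏ i : Fin 3, (X - C (x i))) :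
    a = -(x 0 + x 1 + x 2) ∧ b = x 0 * x 1 + x 1 * x 2 + x 2 * x 0 ∧ c = -(x 0 * x 1 * x 2) := by
  have h (t : ℝ) : t ^ 3 + a * t ^ 2 + b * t + c = (t - x 0) * (t - x 1) * (t - x 2) := by
    simpa [Fin.prod_univ_three] using congrArg (eval t) hf
  have h₀ := h 0
  have h₁ := h 1
  have h₂ := h (-1)
  refine ⟨?_, ?_, ?_⟩ <;> linarith

theorem cubic_positive_root_count (a b c : ℝ) (x : Fin 3 → ℝ)
    (hinj : Function.Injective x) (hne : ∀ i, x i ≠ 0)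
    (hf : (X ^ 3 + C a * X ^ 2 + C b * X + C c : Polynomial ℝ) =
      ∏ i : Fin 3, (X - C (x i))) :
    ((∀ i, x i < 0) ↔ (0 < b ∧ 0 < c ∧ 0 < a * b - 9 * c)) ∧
    ((∀ i, 0 < x i) ↔ (0 < b ∧ c < 0 ∧ a * b - 9 * c < 0)) ∧
    (¬(0 < b ∧ 0 < c ∧ 0 < a * b - 9 * c) → ¬(0 < b ∧ c < 0 ∧ a * b - 9 * c < 0) →
      ((0 < c → (Finset.univ.filter fun i : Fin 3 => 0 < x i).card = 2) ∧
       (c < 0 → (Finset.univ.filter fun i : Fin 3 => 0 < x i).card = 1))) := by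
  obtain ⟨ha, hb, hc⟩ := cubic_coeff_eq_of_eq_prod hf
  have h01 : x 0 ≠ x 1 := hinj.ne (by decide)
  have hneg : (∀ i, x i < 0) ↔ (0 < b ∧ 0 < c ∧ 0 < a * b - 9 * c) := by
    have h := all_pos_iff_esymm (r := -x 2) (neg_injective.ne h01)
    simp only [neg_pos] at h
    rw [Fin.forall_fin_succ, Fin.forall_fin_two]
    refine h.trans (and_congr ?_ (and_congr ?_ ?_)) <;> subst ha hb hc <;>
      constructor <;> intro <;> linarith
  have hpos : (∀ i, 0 < x i) ↔ (0 < b ∧ c < 0 ∧ a * b - 9 * c < 0) := by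
    have h := all_pos_iff_esymm (r := x 2) h01
    rw [Fin.forall_fin_succ, Fin.forall_fin_two]
    refine h.trans (and_congr ?_ (and_congr ?_ ?_)) <;> subst ha hb hc <;>
      constructor <;> intro <;> linarith
  refine ⟨hneg, hpos, fun hn hp => ?_⟩
  rw [← hneg, Fin.forall_fin_succ, Fin.forall_fin_two] at hn
  rw [← hpos, Fin.forall_fin_succ, Fin.forall_fin_two] at hp
  simp only [Fin.succ_zero_eq_one, Fin.succ_one_eq_two] at hn hp
  rw [Finset.card_filter, Fin.sum_univ_three, hc, neg_pos, neg_lt_zero]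
  rcases (hne 0).lt_or_gt with h0 | h0 <;> rcases (hne 1).lt_or_gt with h1 | h1 <;>
    rcases (hne 2).lt_or_gt with h2 | h2 <;>
    simp_all [mul_neg_iff, mul_pos_iff, h0.not_gt, h1.not_gt, h2.not_gt]
end
end
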